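/- Let n,m ≥ 1, 0 < q < 1, 0 < t < 1, and let ξ,ξ′ > 0 be admissible. Then for all P,Q ∈ Λ_{n,m;q,t}, ⟨𝓜_{n,m;q,t}P, Q⟩′_{n,m;q,t}(ξ,ξ′) = ⟨P, 𝓜_{n,m;q,t}Q⟩′_{n,m;q,t}(ξ,ξ′), where the first (resp. second) pairing is the torus integral of Δ_{n,m}(x,y;q,t) · (𝓜_{n,m;q,t}P)(x,y) · Q*(x,y) (resp. Δ_{n,m}(x,y;q,t) · P(x,y) · (𝓜_{n,m;q,t}Q)*(x,y)), the integrand being defined at all torus points where the coefficients A_i, B_j are finite (a set of full measure). -/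

import Mathlib

open Complex MeasureTheory Finset

noncomputable section

/-- The infinite q-Pochhammer symbol `(a;q)_∞`. -/
def qPochInf (a q : ℂ) : ℂ := ∏' k : ℕ, (1 - a * q ^ k)

/-- The weight function `Δ_N(z;q,t)`. -/
def DeltaW {N : ℕ} (q t : ℂ) (z : Fin N → ℂ) : ℂ :=
  ∏ i : Fin N, ∏ j : Fin N,
    if i ≠ j then qPochInf (z i / z j) q / qPochInf (t * (z i / z j)) q else 1

/-- The weight function `Δ_{n,m}(x,y;q,t)` for real parameters `0 < q,t < 1`. -/
def DeltaNM (n m : ℕ) (q t : ℝ) (x : Fin n → ℂ) (y : Fin m → ℂ) : ℂ :=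
  DeltaW (q : ℂ) (t : ℂ) x * DeltaW (t : ℂ) (q : ℂ) y /
    ∏ i : Fin n, ∏ j : Fin m,
      ((1 - (Real.sqrt q : ℂ)⁻¹ * (Real.sqrt t : ℂ) * (x i / y j)) *
        (1 - (Real.sqrt q : ℂ)⁻¹ * (Real.sqrt t : ℂ) * (y j / x i)))

/-- Membership in the algebra `Λ_{n,m;q,t}`: `P` is (the evaluation of) a polynomial in
`x_1,…,x_n,y_1,…,y_m`, symmetric in each set of variables separately, and satisfying the
symmetry condition `T_{q,x_i} P = T_{t⁻¹,y_j} P` at `q^{1/2} x_i = t^{-1/2} y_j`. -/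
def InLambda (n m : ℕ) (q t : ℝ) (P : (Fin n → ℂ) → (Fin m → ℂ) → ℂ) : Prop :=
  (∃ p : MvPolynomial (Fin n ⊕ Fin m) ℂ,
      ∀ (x : Fin n → ℂ) (y : Fin m → ℂ), P x y = MvPolynomial.eval (Sum.elim x y) p) ∧
    (∀ (σ : Equiv.Perm (Fin n)) (τ : Equiv.Perm (Fin m)) (x : Fin n → ℂ) (y : Fin m → ℂ),
      P (x ∘ σ) (y ∘ τ) = P x y) ∧
    ∀ (i : Fin n) (j : Fin m) (x : Fin n → ℂ) (y : Fin m → ℂ),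
      (Real.sqrt q : ℂ) * x i = (Real.sqrt t : ℂ)⁻¹ * y j →
        P (Function.update x i ((q : ℂ) * x i)) y = P x (Function.update y j ((t : ℂ)⁻¹ * y j))

/-- The conjugate `Q*(x,y) = conj (Q(1/conj x, 1/conj y))`. -/
def starFun {n m : ℕ} (Q : (Fin n → ℂ) → (Fin m → ℂ) → ℂ) :
    (Fin n → ℂ) → (Fin m → ℂ) → ℂ := fun x y =>
  starRingEnd ℂ (Q (fun i => (starRingEnd ℂ (x i))⁻¹) (fun j => (starRingEnd ℂ (y j))⁻¹))

/-- The sesquilinear pairing `⟨P,Q⟩′_{n,m;q,t}(ξ,ξ′)`, as an iterated torus integral. -/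
def pairingNM (n m : ℕ) (q t : ℝ) (P Q : (Fin n → ℂ) → (Fin m → ℂ) → ℂ) (ξ ξ' : ℝ) : ℂ :=
  (1 / ((n.factorial : ℂ) * (m.factorial : ℂ))) * (1 / (2 * (Real.pi : ℂ)) ^ (n + m)) *
    ∫ θ in Set.univ.pi fun _ : Fin n => Set.Ioc (0 : ℝ) (2 * Real.pi),
      ∫ φ in Set.univ.pi fun _ : Fin m => Set.Ioc (0 : ℝ) (2 * Real.pi),
        DeltaNM n m q t (fun i => (ξ : ℂ) * Complex.exp (Complex.I * (θ i : ℂ)))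
            (fun j => (ξ' : ℂ) * Complex.exp (Complex.I * (φ j : ℂ))) *
          P (fun i => (ξ : ℂ) * Complex.exp (Complex.I * (θ i : ℂ)))
            (fun j => (ξ' : ℂ) * Complex.exp (Complex.I * (φ j : ℂ))) *
          starFun Q (fun i => (ξ : ℂ) * Complex.exp (Complex.I * (θ i : ℂ)))
            (fun j => (ξ' : ℂ) * Complex.exp (Complex.I * (φ j : ℂ)))

/-- `M(q,t) = max(q^{1/2} t^{-1/2}, q^{-1/2} t^{1/2})`. -/
def Mmax (q t : ℝ) : ℝ := max (Real.sqrt q / Real.sqrt t) (Real.sqrt t / Real.sqrt q)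

/-- Radii `ξ, ξ′ > 0` are admissible if `ξ/ξ′ > M(q,t)` or `ξ/ξ′ < 1/M(q,t)`. -/
def Admissible (q t ξ ξ' : ℝ) : Prop := ξ / ξ' > Mmax q t ∨ ξ / ξ' < (Mmax q t)⁻¹

/-- The coefficient `A_i(x,y;q,t)`. -/
def Acoef (n m : ℕ) (q t : ℝ) (i : Fin n) (x : Fin n → ℂ) (y : Fin m → ℂ) : ℂ :=
  (∏ i' : Fin n, if i' ≠ i then ((t : ℂ) * x i - x i') / (x i - x i') else 1) *
    ∏ j : Fin m,
      ((Real.sqrt t : ℂ) * x i - (Real.sqrt q : ℂ) * y j) /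
        ((Real.sqrt t : ℂ) * x i - (Real.sqrt q : ℂ)⁻¹ * y j)

/-- The coefficient `B_j(x,y;q,t)`. -/
def Bcoef (n m : ℕ) (q t : ℝ) (j : Fin m) (x : Fin n → ℂ) (y : Fin m → ℂ) : ℂ :=
  (∏ j' : Fin m, if j' ≠ j then ((q : ℂ)⁻¹ * y j - y j') / (y j - y j') else 1) *
    ∏ i : Fin n,
      ((Real.sqrt q : ℂ)⁻¹ * y j - (Real.sqrt t : ℂ)⁻¹ * x i) /
        ((Real.sqrt q : ℂ)⁻¹ * y j - (Real.sqrt t : ℂ) * x i)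

/-- The deformed Macdonald–Ruijsenaars operator `M_{n,m;q,t}`. -/
def McalOp (n m : ℕ) (q t : ℝ) (F : (Fin n → ℂ) → (Fin m → ℂ) → ℂ) :
    (Fin n → ℂ) → (Fin m → ℂ) → ℂ := fun x y =>
  (t : ℂ) ^ ((1 : ℤ) - n) / (1 - (q : ℂ)) *
      ∑ i : Fin n, Acoef n m q t i x y * (F (Function.update x i ((q : ℂ) * x i)) y - F x y) +
    (q : ℂ) ^ ((m : ℤ) - 1) / (1 - (t : ℂ)⁻¹) *
      ∑ j : Fin m, Bcoef n m q t j x y * (F x (Function.update y j ((t : ℂ)⁻¹ * y j)) - F x y)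

section QPoch

lemma summable_norm_mul_pow {q : ℂ} (hq : ‖q‖ < 1) (a : ℂ) :
    Summable fun k : ℕ => ‖-(a * q ^ k)‖ := by
  simpa [norm_mul, norm_pow] using
    (summable_geometric_of_lt_one (norm_nonneg q) hq).mul_left ‖a‖

lemma multipliable_qPochInf {q : ℂ} (hq : ‖q‖ < 1) (a : ℂ) :
    Multipliable fun k : ℕ => (1 - a * q ^ k) := by
  simpa [sub_eq_add_neg] using multipliable_one_add_of_summable (summable_norm_mul_pow hq a)

lemma qPochInf_eq_one_sub_mul {q : ℂ} (hq : ‖q‖ < 1) (a : ℂ) :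
    qPochInf a q = (1 - a) * qPochInf (q * a) q := by
  have h : ∀ k : ℕ, 1 - a * q ^ (k + 1) = 1 - q * a * q ^ k := fun k => by ring
  have := tprod_eq_zero_mul' (f := fun k : ℕ => (1 - a * q ^ k)) (by
    simpa only [h] using multipliable_qPochInf hq (q * a))
  simpa only [qPochInf, h, pow_zero, mul_one] using this

lemma qPochInf_ne_zero {q : ℂ} (hq : ‖q‖ < 1) {a : ℂ} (ha : ‖a‖ < 1) : qPochInf a q ≠ 0 := by
  have := tprod_one_add_ne_zero_of_summable (f := fun k : ℕ => -(a * q ^ k)) (fun k h => by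
    have h1 : a * q ^ k = 1 := by linear_combination -h
    have h2 : ‖a * q ^ k‖ < 1 := by
      rw [norm_mul, norm_pow]
      exact (mul_le_of_le_one_right (norm_nonneg a)
        (pow_le_one₀ (norm_nonneg q) hq.le)).trans_lt ha
    simp [h1] at h2) (summable_norm_mul_pow hq a)
  simpa [qPochInf, sub_eq_add_neg] using this

lemma differentiable_qPochInf {q : ℂ} (hq : ‖q‖ < 1) :
    Differentiable ℂ fun a => qPochInf a q := by
  intro a
  have hU : IsOpen (Metric.ball (0 : ℂ) (‖a‖ + 1)) := Metric.isOpen_ball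
  have h := Summable.hasProdLocallyUniformlyOn_nat_one_add (f := fun (k : ℕ) (b : ℂ) => -(b * q ^ k)) hU
    ((summable_geometric_of_lt_one (norm_nonneg q) hq).mul_left (‖a‖ + 1))
    (.of_forall fun k b hb => by
      rw [norm_neg, norm_mul, norm_pow]
      gcongr
      simpa using (Metric.mem_ball.1 hb).le) (fun k => by fun_prop)
  have h2 := h.differentiableOn (.of_forall fun _ ↦ by
    simpa [Finset.prod_fn] using DifferentiableOn.finsetProd (fun _ _ ↦ by fun_prop)) hU
  have h3 := h2.differentiableAt (x := a) (hU.mem_nhds (by simp))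
  simpa [qPochInf, sub_eq_add_neg] using h3

end QPoch

section Torus

instance fact_zero_lt_two_pi : Fact ((0 : ℝ) < 2 * Real.pi) := ⟨Real.two_pi_pos⟩

/-- The character `θ ↦ e^{iθ}` of the circle group `ℝ/2πℤ`. -/
def circleExp (α : AddCircle (2 * Real.pi)) : ℂ := Circle.coeHom (AddCircle.toCircle α)

lemma circleExp_add (α β : AddCircle (2 * Real.pi)) :
    circleExp (α + β) = circleExp α * circleExp β := by
  simp [circleExp, AddCircle.toCircle_add]

@[simp] lemma norm_circleExp (α : AddCircle (2 * Real.pi)) : ‖circleExp α‖ = 1 :=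
  Circle.norm_coe _

lemma continuous_circleExp : Continuous circleExp :=
  continuous_induced_dom.comp AddCircle.continuous_toCircle

lemma circleExp_coe (θ : ℝ) : circleExp (θ : AddCircle (2 * Real.pi)) = exp (I * θ) := by
  simp only [circleExp, AddCircle.toCircle_apply_mk, div_self Real.two_pi_pos.ne', one_mul]
  rw [mul_comm]
  exact Circle.coe_exp θ

lemma injective_circleExp : Function.Injective circleExp :=
  Circle.coe_injective.comp (AddCircle.injective_toCircle Real.two_pi_pos.ne')

lemma circleExp_neg (α : AddCircle (2 * Real.pi)) : circleExp (-α) = (circleExp α)⁻¹ := by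
  simp [circleExp, AddCircle.toCircle_neg]

/-- The product of an `n`-torus and an `m`-torus, as an additive group. -/
abbrev Torus (n m : ℕ) : Type :=
  (Fin n → AddCircle (2 * Real.pi)) × (Fin m → AddCircle (2 * Real.pi))

instance isAddHaarMeasure_volume_torus (n m : ℕ) :
    (volume : Measure (Torus n m)).IsAddHaarMeasure :=
  Measure.prod.instIsAddHaarMeasure (volume : Measure (Fin n → AddCircle (2 * Real.pi)))
    (volume : Measure (Fin m → AddCircle (2 * Real.pi)))

/-- The point of `ℂⁿ` with polar coordinates `(ξ, u i)`. -/
def torusPt {n : ℕ} (ξ : ℝ) (u : Fin n → AddCircle (2 * Real.pi)) : Fin n → ℂ :=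
  fun i => (ξ : ℂ) * circleExp (u i)

/-- The integral over the torus of radii `ξ`, `ξ'`. -/
def torusInt {n m : ℕ} (ξ ξ' : ℝ) (F : (Fin n → ℂ) → (Fin m → ℂ) → ℂ) : ℂ :=
  ∫ w : Torus n m, F (torusPt ξ w.1) (torusPt ξ' w.2)

lemma norm_torusPt {n : ℕ} {ξ : ℝ} (hξ : 0 < ξ) (u : Fin n → AddCircle (2 * Real.pi)) (i : Fin n) :
    ‖torusPt ξ u i‖ = ξ := by
  simp [torusPt, abs_of_pos hξ]

lemma torusPt_ne_zero {n : ℕ} {ξ : ℝ} (hξ : 0 < ξ) (u : Fin n → AddCircle (2 * Real.pi))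
    (i : Fin n) : torusPt ξ u i ≠ 0 := by
  rw [← norm_ne_zero_iff, norm_torusPt hξ]; exact hξ.ne'

lemma continuous_torusPt {n : ℕ} (ξ : ℝ) :
    Continuous (torusPt ξ : (Fin n → AddCircle (2 * Real.pi)) → Fin n → ℂ) := by
  refine continuous_pi fun i => continuous_const.mul ?_
  exact continuous_circleExp.comp (continuous_apply i)

lemma integral_addCircle_eq_circleIntegral (g : ℂ → ℂ) (R : ℝ) (hR : R ≠ 0) :
    (∮ z in C(0, R), (z - 0)⁻¹ • g z) =
      I * ∫ α : AddCircle (2 * Real.pi), g (R * circleExp α) := by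
  have h := AddCircle.intervalIntegral_preimage (2 * Real.pi) 0
    (fun α : AddCircle (2 * Real.pi) => g (R * circleExp α))
  rw [← h, circleIntegral, ← intervalIntegral.integral_const_mul, zero_add]
  refine intervalIntegral.integral_congr fun θ _ => ?_
  have h2 : circleMap 0 R θ ≠ 0 := circleMap_ne_center hR
  simp only [deriv_circleMap, sub_zero, smul_eq_mul, circleExp_coe]
  rw [show (R : ℂ) * exp (I * θ) = circleMap 0 R θ by simp [circleMap, mul_comm]]
  field_simp

/-- Contour shifting for a family of functions on an annulus, parametrised by a compact group on
which rotations of the annulus act by translations. -/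
lemma integral_annulus_eq {X : Type*} [TopologicalSpace X] [CompactSpace X] [AddCommGroup X]
    [MeasurableSpace X] [BorelSpace X] [SecondCountableTopology X] [ContinuousAdd X]
    (μ : Measure X) [IsFiniteMeasure μ] [μ.IsAddLeftInvariant] (f : X → ℂ → ℂ) {a b : ℝ}
    (ha : 0 < a) (hab : a ≤ b)
    (hc : ∀ u s, a ≤ ‖s‖ → ‖s‖ ≤ b → ContinuousAt (fun p : X × ℂ => f p.1 p.2) (u, s))
    (hd : ∀ u s, a ≤ ‖s‖ → ‖s‖ ≤ b → DifferentiableAt ℂ (f u) s)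
    (htr : ∀ α : AddCircle (2 * Real.pi), ∃ v : X, ∀ u, ∀ R : ℝ,
      f u (R * circleExp α) = f (v + u) R) :
    ∫ u, f u b ∂μ = ∫ u, f u a ∂μ := by
  have key : ∀ R : ℝ, a ≤ R → R ≤ b → ∫ u, (∮ z in C(0, R), (z - 0)⁻¹ • f u z) ∂μ =
      (I * (2 * Real.pi)) * ∫ u, f u R ∂μ := by
    intro R haR hRb
    have hR : 0 < R := ha.trans_le haR
    simp_rw [integral_addCircle_eq_circleIntegral _ R hR.ne']
    rw [integral_const_mul, integral_integral_swap]
    · have : ∀ α : AddCircle (2 * Real.pi),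
          ∫ u, f u (R * circleExp α) ∂μ = ∫ u, f u R ∂μ := by
        intro α
        obtain ⟨v, hv⟩ := htr α
        simp_rw [hv]
        exact integral_add_left_eq_self (fun u => f u R) v
      simp_rw [this]
      rw [integral_const, Measure.real, AddCircle.measure_univ, ENNReal.toReal_ofReal
        Real.two_pi_pos.le]
      simp [mul_assoc]
    · have : Continuous (Function.uncurry fun (u : X) (α : AddCircle (2 * Real.pi)) =>
          f u (R * circleExp α)) := by
        rw [continuous_iff_continuousAt]
        rintro ⟨u, α⟩
        have h1 := hc u (R * circleExp α) (by simpa [abs_of_pos hR] using haR)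
          (by simpa [abs_of_pos hR] using hRb)
        exact ContinuousAt.comp (f := fun p : X × AddCircle (2 * Real.pi) =>
          (p.1, (R * circleExp p.2))) (g := fun p : X × ℂ => f p.1 p.2) h1
          (Continuous.continuousAt (continuous_fst.prodMk (continuous_const.mul
            (continuous_circleExp.comp continuous_snd))))
      exact this.integrable_of_hasCompactSupport (.of_compactSpace _)
  have hca : ∀ u, (∮ z in C(0, b), (z - 0)⁻¹ • f u z) = ∮ z in C(0, a), (z - 0)⁻¹ • f u z := by
    intro u
    refine circleIntegral_sub_center_inv_smul_eq_of_differentiable_on_annulus_off_countable ha hab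
      Set.countable_empty (fun z hz => ?_) fun z hz => ?_
    · simp only [Set.mem_sdiff, Metric.mem_closedBall, Metric.mem_ball, dist_zero_right, not_lt]
        at hz
      exact (hd u z hz.2 hz.1).continuousAt.continuousWithinAt
    · simp only [Set.mem_sdiff, Metric.mem_closedBall, Metric.mem_ball, dist_zero_right,
        not_le] at hz
      exact hd u z hz.1.2.le hz.1.1.le
  have hA := key a le_rfl hab
  have hB := key b hab le_rfl
  simp_rw [hca] at hB
  rw [hA] at hB
  refine (mul_left_cancel₀ ?_ hB).symm
  simp [Real.pi_ne_zero]

/-- Multiplication by `s` of the coordinates with index in `S`. -/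
def scaleOn {n : ℕ} (S : Finset (Fin n)) (s : ℂ) (x : Fin n → ℂ) : Fin n → ℂ :=
  fun i => if i ∈ S then s * x i else x i

/-- The function `F` is complex differentiable at `(x, y)`. -/
def DiffAt₂ {n m : ℕ} (F : (Fin n → ℂ) → (Fin m → ℂ) → ℂ) (x : Fin n → ℂ) (y : Fin m → ℂ) :
    Prop :=
  DifferentiableAt ℂ (fun z : (Fin n → ℂ) × (Fin m → ℂ) => F z.1 z.2) (x, y)

lemma continuous_comp_torusPt {n m : ℕ} {ξ ξ' : ℝ} {F : (Fin n → ℂ) → (Fin m → ℂ) → ℂ}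
    (hF : ∀ w : Torus n m, DiffAt₂ F (torusPt ξ w.1) (torusPt ξ' w.2)) :
    Continuous fun w : Torus n m => F (torusPt ξ w.1) (torusPt ξ' w.2) := by
  rw [continuous_iff_continuousAt]
  intro w
  exact ContinuousAt.comp (f := fun w : Torus n m => (torusPt ξ w.1, torusPt ξ' w.2))
    (hF w).continuousAt
    (((continuous_torusPt ξ).comp continuous_fst).prodMk
      ((continuous_torusPt ξ').comp continuous_snd)).continuousAt

lemma integrable_comp_torusPt {n m : ℕ} {ξ ξ' : ℝ} {F : (Fin n → ℂ) → (Fin m → ℂ) → ℂ}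
    (hF : ∀ w : Torus n m, DiffAt₂ F (torusPt ξ w.1) (torusPt ξ' w.2)) :
    Integrable fun w : Torus n m => F (torusPt ξ w.1) (torusPt ξ' w.2) :=
  (continuous_comp_torusPt hF).integrable_of_hasCompactSupport (.of_compactSpace _)

lemma torusInt_scaleOn_eq {n m : ℕ} {ξ ξ' : ℝ} (F : (Fin n → ℂ) → (Fin m → ℂ) → ℂ)
    (S : Finset (Fin n)) {a b : ℝ} (ha : 0 < a) (hab : a ≤ b)
    (hF : ∀ w : Torus n m, ∀ s : ℂ, a ≤ ‖s‖ → ‖s‖ ≤ b →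
      DiffAt₂ F (scaleOn S s (torusPt ξ w.1)) (torusPt ξ' w.2)) :
    torusInt ξ ξ' (fun x y => F (scaleOn S b x) y) =
      torusInt ξ ξ' (fun x y => F (scaleOn S a x) y) := by
  refine integral_annulus_eq (X := Torus n m) volume
    (fun w s => F (scaleOn S s (torusPt ξ w.1)) (torusPt ξ' w.2)) ha hab ?_ ?_ ?_
  · intro w s h1 h2
    refine ContinuousAt.comp (f := fun p : Torus n m × ℂ =>
      (scaleOn S p.2 (torusPt ξ p.1.1), torusPt ξ' p.1.2))
      (g := fun z : (Fin n → ℂ) × (Fin m → ℂ) => F z.1 z.2) (hF w s h1 h2).continuousAt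
      (Continuous.continuousAt (Continuous.prodMk ?_ ?_))
    · refine continuous_pi fun i => ?_
      have : Continuous fun p : Torus n m × ℂ => torusPt ξ p.1.1 i :=
        (continuous_apply i).comp ((continuous_torusPt ξ).comp
          (continuous_fst.comp continuous_fst))
      unfold scaleOn
      split_ifs
      · exact continuous_snd.mul this
      · exact this
    · exact (continuous_torusPt ξ').comp (continuous_snd.comp continuous_fst)
  · intro w s h1 h2
    refine DifferentiableAt.comp (f := fun s : ℂ =>
      (scaleOn S s (torusPt ξ w.1), torusPt ξ' w.2)) s (hF w s h1 h2) ?_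
    refine DifferentiableAt.prodMk ?_ (differentiableAt_const _)
    rw [differentiableAt_pi]
    intro i
    unfold scaleOn
    split_ifs <;> fun_prop
  · intro α
    refine ⟨(fun i => if i ∈ S then α else 0, 0), fun w R => ?_⟩
    congr 1
    · funext i
      by_cases hi : i ∈ S
      · simp [scaleOn, torusPt, hi, circleExp_add]; ring
      · simp [scaleOn, torusPt, hi]
    · simp

end Torus

section Generic

/-- Points at which no factor occurring in a denominator of the deformed Macdonald–Ruijsenaars
operator, or of its image under inversion of the variables, vanishes. -/
structure GenericPt {n m : ℕ} (q t : ℝ) (x : Fin n → ℂ) (y : Fin m → ℂ) : Prop where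
  x_ne_zero : ∀ i, x i ≠ 0
  y_ne_zero : ∀ j, y j ≠ 0
  x_ne : ∀ i k, i ≠ k → x i ≠ x k
  y_ne : ∀ j l, j ≠ l → y j ≠ y l
  mul_x_ne : ∀ i j, (Real.sqrt q : ℂ) * (Real.sqrt t : ℂ) * x i ≠ y j
  x_ne_mul : ∀ i j, x i ≠ (Real.sqrt q : ℂ) * (Real.sqrt t : ℂ) * y j

instance nontrivial_addCircle : Nontrivial (AddCircle (2 * Real.pi)) := by
  refine ⟨((0 : ℝ) : AddCircle (2 * Real.pi)), (Real.pi : ℝ), fun h => ?_⟩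
  have h1 := congrArg circleExp h
  rw [circleExp_coe, circleExp_coe, mul_comm Complex.I (Real.pi : ℂ), Complex.exp_pi_mul_I] at h1
  norm_num at h1

lemma ae_hom_ne {n m : ℕ} (f : Torus n m →+ AddCircle (2 * Real.pi)) (hf : Continuous f)
    (hs : Function.Surjective f) (a : AddCircle (2 * Real.pi)) :
    ∀ᵐ w : Torus n m, f w ≠ a := by
  have h := Measure.isAddHaarMeasure_map_of_isFiniteMeasure (volume : Measure (Torus n m)) f hf hs
  have h0 : (Measure.map f (volume : Measure (Torus n m))) {a} = 0 := measure_singleton a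
  rw [Measure.map_apply hf.measurable (measurableSet_singleton a)] at h0
  rw [ae_iff]
  simpa using! h0

lemma ae_mul_circleExp_ne {n m : ℕ} (f g : Torus n m →+ AddCircle (2 * Real.pi))
    (hf : Continuous f) (hg : Continuous g) (hs : Function.Surjective (f - g)) {c : ℂ}
    (hc : c ≠ 0) (d : ℂ) :
    ∀ᵐ w : Torus n m, c * circleExp (f w) ≠ d * circleExp (g w) := by
  by_cases h : ∃ a, circleExp a = d / c
  · obtain ⟨a, ha⟩ := h
    filter_upwards [ae_hom_ne (f - g) (by simpa using! hf.sub hg) hs a] with w hw h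
    refine hw (injective_circleExp ?_)
    have h1 : circleExp (g w) ≠ 0 := by
      rw [← norm_ne_zero_iff, norm_circleExp]; exact one_ne_zero
    rw [ha, AddMonoidHom.sub_apply, sub_eq_add_neg, circleExp_add, circleExp_neg]
    field_simp
    linear_combination h
  · refine .of_forall fun w hw => h ⟨f w - g w, ?_⟩
    have h1 : circleExp (g w) ≠ 0 := by
      rw [← norm_ne_zero_iff, norm_circleExp]; exact one_ne_zero
    rw [sub_eq_add_neg, circleExp_add, circleExp_neg]
    field_simp
    linear_combination hw

lemma ae_genericPt {n m : ℕ} {q t : ℝ} (hq : 0 < q) (ht : 0 < t) {ξ ξ' : ℝ} (hξ : 0 < ξ)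
    (hξ' : 0 < ξ') :
    ∀ᵐ w : Torus n m, GenericPt q t (torusPt ξ w.1) (torusPt ξ' w.2) := by
  let X (i : Fin n) : Torus n m →+ AddCircle (2 * Real.pi) :=
    (Pi.evalAddMonoidHom _ i).comp (AddMonoidHom.fst _ _)
  let Y (j : Fin m) : Torus n m →+ AddCircle (2 * Real.pi) :=
    (Pi.evalAddMonoidHom _ j).comp (AddMonoidHom.snd _ _)
  have hX : ∀ i, Continuous (X i) := fun i => (continuous_apply i).comp continuous_fst
  have hY : ∀ j, Continuous (Y j) := fun j => (continuous_apply j).comp continuous_snd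
  have cξ : (ξ : ℂ) ≠ 0 := by exact_mod_cast hξ.ne'
  have cξ' : (ξ' : ℂ) ≠ 0 := by exact_mod_cast hξ'.ne'
  have cq : (Real.sqrt q : ℂ) ≠ 0 := by exact_mod_cast (Real.sqrt_pos.2 hq).ne'
  have ct : (Real.sqrt t : ℂ) ≠ 0 := by exact_mod_cast (Real.sqrt_pos.2 ht).ne'
  have sXX : ∀ i k, i ≠ k → Function.Surjective (X i - X k) := fun i k h a =>
    ⟨(Pi.single i a, 0), by simp [X, h.symm]⟩
  have sYY : ∀ j l, j ≠ l → Function.Surjective (Y j - Y l) := fun j l h a =>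
    ⟨(0, Pi.single j a), by simp [Y, h.symm]⟩
  have sXY : ∀ i j, Function.Surjective (X i - Y j) := fun i j a =>
    ⟨(Pi.single i a, 0), by simp [X, Y]⟩
  have h1 : ∀ᵐ w : Torus n m, ∀ i k, i ≠ k → torusPt ξ w.1 i ≠ torusPt ξ w.1 k := by
    simp only [ae_all_iff]
    exact fun i k h => ae_mul_circleExp_ne (X i) (X k) (hX i) (hX k) (sXX i k h) cξ ξ
  have h2 : ∀ᵐ w : Torus n m, ∀ j l, j ≠ l → torusPt ξ' w.2 j ≠ torusPt ξ' w.2 l := by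
    simp only [ae_all_iff]
    exact fun j l h => ae_mul_circleExp_ne (Y j) (Y l) (hY j) (hY l) (sYY j l h) cξ' ξ'
  have h3 : ∀ᵐ w : Torus n m, ∀ i j,
      (Real.sqrt q : ℂ) * (Real.sqrt t : ℂ) * torusPt ξ w.1 i ≠ torusPt ξ' w.2 j := by
    simp only [ae_all_iff, torusPt, ← mul_assoc]
    exact fun i j => ae_mul_circleExp_ne (X i) (Y j) (hX i) (hY j) (sXY i j)
      (mul_ne_zero (mul_ne_zero cq ct) cξ) ξ'
  have h4 : ∀ᵐ w : Torus n m, ∀ i j,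
      torusPt ξ w.1 i ≠ (Real.sqrt q : ℂ) * (Real.sqrt t : ℂ) * torusPt ξ' w.2 j := by
    simp only [ae_all_iff, torusPt, ← mul_assoc]
    exact fun i j => ae_mul_circleExp_ne (X i) (Y j) (hX i) (hY j) (sXY i j) cξ _
  filter_upwards [h1, h2, h3, h4] with w h1 h2 h3 h4
  exact ⟨torusPt_ne_zero hξ _, torusPt_ne_zero hξ' _, h1, h2, h3, h4⟩

end Generic

section Pairing

lemma measurePreserving_pi_mk (n : ℕ) :
    MeasurePreserving (fun (θ : Fin n → ℝ) (i : Fin n) => (θ i : AddCircle (2 * Real.pi)))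
      (volume.restrict (Set.univ.pi fun _ : Fin n => Set.Ioc (0 : ℝ) (2 * Real.pi))) volume := by
  have h := measurePreserving_pi (fun _ : Fin n => volume.restrict (Set.Ioc (0 : ℝ) (2 * Real.pi)))
    (fun _ => (volume : Measure (AddCircle (2 * Real.pi)))) (fun _ => by
      simpa using AddCircle.measurePreserving_mk (2 * Real.pi) 0)
  rw [volume_pi, Measure.restrict_pi_pi]
  exact h

/-- An iterated integral over boxes of a function agreeing almost everywhere with a continuous
function on the torus is an integral over the torus. -/
lemma integral_box_eq_torusInt {n m : ℕ} {ξ ξ' : ℝ} (F G : (Fin n → ℂ) → (Fin m → ℂ) → ℂ)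
    (hG : Continuous fun w : Torus n m => G (torusPt ξ w.1) (torusPt ξ' w.2))
    (hFG : ∀ᵐ w : Torus n m,
      F (torusPt ξ w.1) (torusPt ξ' w.2) = G (torusPt ξ w.1) (torusPt ξ' w.2)) :
    (∫ θ in Set.univ.pi fun _ : Fin n => Set.Ioc (0 : ℝ) (2 * Real.pi),
      ∫ φ in Set.univ.pi fun _ : Fin m => Set.Ioc (0 : ℝ) (2 * Real.pi),
        F (fun i => (ξ : ℂ) * Complex.exp (Complex.I * (θ i : ℂ)))
          (fun j => (ξ' : ℂ) * Complex.exp (Complex.I * (φ j : ℂ)))) =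
      torusInt ξ ξ' F := by
  have hmp := (measurePreserving_pi_mk n).prod (measurePreserving_pi_mk m)
  set μ := volume.restrict (Set.univ.pi fun _ : Fin n => Set.Ioc (0 : ℝ) (2 * Real.pi))
  set ν := volume.restrict (Set.univ.pi fun _ : Fin m => Set.Ioc (0 : ℝ) (2 * Real.pi))
  set K : (Fin n → ℝ) × (Fin m → ℝ) → Torus n m := Prod.map
    (fun θ i => (θ i : AddCircle (2 * Real.pi))) (fun φ j => (φ j : AddCircle (2 * Real.pi)))
    with hK
  have hI : Integrable (fun w : Torus n m => G (torusPt ξ w.1) (torusPt ξ' w.2)) :=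
    hG.integrable_of_hasCompactSupport (.of_compactSpace _)
  have hx : ∀ θ : Fin n → ℝ, (fun i => (ξ : ℂ) * Complex.exp (Complex.I * (θ i : ℂ))) =
      torusPt ξ fun i => (θ i : AddCircle (2 * Real.pi)) := fun θ => by
    funext i; simp [torusPt, circleExp_coe]
  have hy : ∀ φ : Fin m → ℝ, (fun j => (ξ' : ℂ) * Complex.exp (Complex.I * (φ j : ℂ))) =
      torusPt ξ' fun j => (φ j : AddCircle (2 * Real.pi)) := fun θ => by
    funext i; simp [torusPt, circleExp_coe]
  simp only [hx, hy]
  have hae := Measure.ae_ae_of_ae_prod (hmp.quasiMeasurePreserving.ae hFG)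
  have h1 : (∫ θ, ∫ φ, F (torusPt ξ (K (θ, φ)).1) (torusPt ξ' (K (θ, φ)).2) ∂ν ∂μ) =
      ∫ θ, ∫ φ, G (torusPt ξ (K (θ, φ)).1) (torusPt ξ' (K (θ, φ)).2) ∂ν ∂μ :=
    integral_congr_ae (hae.mono fun θ hθ => integral_congr_ae hθ)
  have hIK : Integrable (fun z => G (torusPt ξ (K z).1) (torusPt ξ' (K z).2)) (μ.prod ν) :=
    hmp.integrable_comp_of_integrable hI
  have h2 := integral_prod _ hIK
  refine (h1.trans h2.symm).trans ?_
  rw [torusInt, integral_congr_ae hFG]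
  have h3 := integral_map hmp.measurable.aemeasurable (f := fun w : Torus n m =>
    G (torusPt ξ w.1) (torusPt ξ' w.2)) (by rw [hmp.map_eq]; exact hI.aestronglyMeasurable)
  rw [hmp.map_eq] at h3
  exact h3.symm

end Pairing

section Constant

lemma sum_lagrange_eq {ι : Type*} [Fintype ι] [DecidableEq ι] (z a : ι → ℂ)
    (hz : Function.Injective z) (h0 : ∀ k, z k ≠ 0) :
    ∑ k, (z k - a k) / z k * ∏ l, (if l ≠ k then (z k - a l) / (z k - z l) else 1) =
      1 - ∏ l, a l / z l := by
  classical
  let f : Polynomial ℂ := Lagrange.nodal univ a - Lagrange.nodal univ z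
  have hdeg : f.degree < #(univ : Finset ι) := by
    have h := Polynomial.degree_sub_lt_left (p := Lagrange.nodal univ a) (q := Lagrange.nodal univ z)
      (by rw [Lagrange.degree_nodal, Lagrange.degree_nodal]) Lagrange.nodal_ne_zero
      (by rw [Lagrange.nodal_monic.leadingCoeff, Lagrange.nodal_monic.leadingCoeff])
    rwa [Lagrange.degree_nodal] at h
  have h1 := Lagrange.eq_interpolate_of_eval_eq (s := univ) (v := z)
    (fun k => ∏ l, (z k - a l)) hz.injOn hdeg (fun k _ => by
      simp only [f, Polynomial.eval_sub, Lagrange.eval_nodal_at_node (mem_univ k), sub_zero,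
        Lagrange.eval_nodal])
  have h2 := congrArg (Polynomial.eval 0) h1
  rw [Lagrange.eval_interpolate_not_at_node _ fun k _ => (h0 k).symm] at h2
  simp only [f, Polynomial.eval_sub, Lagrange.eval_nodal, zero_sub] at h2
  have h3 : ∏ l, -z l ≠ 0 := prod_ne_zero_iff.2 fun l _ => neg_ne_zero.2 (h0 l)
  have h4 : ∏ l, a l / z l = (∏ l, -a l) / ∏ l, -z l := by
    rw [← prod_div_distrib]
    exact prod_congr rfl fun l _ => (neg_div_neg_eq _ _).symm
  rw [h4, eq_sub_iff_add_eq, ← mul_left_inj' h3, add_mul, div_mul_cancel₀ _ h3, one_mul]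
  have h5 : ∑ k, Lagrange.nodalWeight univ z k * (-z k)⁻¹ * ∏ l, (z k - a l) =
      -∑ k, (z k - a k) / z k * ∏ l, (if l ≠ k then (z k - a l) / (z k - z l) else 1) := by
    rw [← sum_neg_distrib]
    refine sum_congr rfl fun k _ => ?_
    rw [Lagrange.nodalWeight, ← mul_prod_erase univ (fun l => z k - a l) (mem_univ k),
      ← mul_prod_erase univ _ (mem_univ k)]
    have h6 : ∏ l ∈ univ.erase k, (if l ≠ k then (z k - a l) / (z k - z l) else 1) =
        (∏ l ∈ univ.erase k, (z k - z l)⁻¹) * ∏ l ∈ univ.erase k, (z k - a l) := by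
      rw [← prod_mul_distrib]
      refine prod_congr rfl fun l hl => ?_
      rw [if_pos (ne_of_mem_erase hl)]
      ring
    rw [h6, inv_neg]
    simp only [ne_eq, not_true, if_false]
    ring
  rw [h5] at h2
  linear_combination h2

/-- The value of the sum of all coefficients of the shift operators. -/
def shiftConst (n m : ℕ) (q t : ℝ) : ℝ :=
  (1 - t⁻¹ ^ n * q ^ m) / ((1 - q) * (1 - t⁻¹))

/-- Coefficient in front of the `x`-shifts. -/
def xCoef (n : ℕ) (q t : ℝ) : ℝ := t ^ ((1 : ℤ) - n) / (1 - q)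

/-- Coefficient in front of the `y`-shifts. -/
def yCoef (m : ℕ) (q t : ℝ) : ℝ := q ^ ((m : ℤ) - 1) / (1 - t⁻¹)

lemma sum_coef_eq {n m : ℕ} {q t : ℝ} (hq : 0 < q) (hq1 : q < 1) (ht : 0 < t) (ht1 : t < 1)
    {x : Fin n → ℂ} {y : Fin m → ℂ} (h : GenericPt q t x y) :
    xCoef n q t * ∑ i, Acoef n m q t i x y + yCoef m q t * ∑ j, Bcoef n m q t j x y =
      shiftConst n m q t := by
  obtain ⟨r, hr, rfl⟩ : ∃ r : ℝ, 0 < r ∧ q = r ^ 2 :=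
    ⟨√q, Real.sqrt_pos.2 hq, (Real.sq_sqrt hq.le).symm⟩
  obtain ⟨s, hs, rfl⟩ : ∃ s : ℝ, 0 < s ∧ t = s ^ 2 :=
    ⟨√t, Real.sqrt_pos.2 ht, (Real.sq_sqrt ht.le).symm⟩
  have cr : (r : ℂ) ≠ 0 := by exact_mod_cast hr.ne'
  have cs : (s : ℂ) ≠ 0 := by exact_mod_cast hs.ne'
  have cr1 : (1 : ℂ) - r ^ 2 ≠ 0 := by
    exact_mod_cast (sub_pos.2 hq1).ne'
  have cs1 : (1 : ℂ) - (s ^ 2 : ℂ)⁻¹ ≠ 0 := by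
    have : 1 - (s ^ 2)⁻¹ ≠ 0 := (sub_neg.2 ((one_lt_inv₀ ht).2 ht1)).ne
    exact_mod_cast this
  have hml := h.mul_x_ne
  rw [Real.sqrt_sq hr.le, Real.sqrt_sq hs.le] at hml
  have hL := sum_lagrange_eq (ι := Fin n ⊕ Fin m) (Sum.elim x fun j => (r * s : ℂ)⁻¹ * y j)
    (Sum.elim (fun i => (s ^ 2 : ℂ)⁻¹ * x i) fun j => (r / s : ℂ) * y j) (by
      rintro (i | j) (k | l) hkl
      · exact congrArg Sum.inl (by_contra fun hik => h.x_ne _ _ hik hkl)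
      · refine absurd hkl fun hkl => hml i l ?_
        simp only [Sum.elim_inl, Sum.elim_inr] at hkl
        rw [hkl]; field_simp
      · refine absurd hkl fun hkl => hml k j ?_
        simp only [Sum.elim_inl, Sum.elim_inr] at hkl
        rw [← hkl]; field_simp
      · refine congrArg Sum.inr (by_contra fun hik => h.y_ne _ _ hik ?_)
        exact mul_left_cancel₀ (inv_ne_zero (mul_ne_zero cr cs)) hkl)
    (by
      rintro (i | j)
      · exact h.x_ne_zero i
      · exact mul_ne_zero (inv_ne_zero (mul_ne_zero cr cs)) (h.y_ne_zero j))
  simp only [Fintype.sum_sum_type, Fintype.prod_sum_type, Sum.elim_inl, Sum.elim_inr, ne_eq,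
    Sum.inl.injEq, Sum.inr.injEq, reduceCtorEq, not_false_eq_true, if_true] at hL
  have hA : ∀ i, (x i - (s ^ 2 : ℂ)⁻¹ * x i) / x i * 
      ((∏ k, if ¬k = i then (x i - (s ^ 2 : ℂ)⁻¹ * x k) / (x i - x k) else 1) *
        ∏ j, (x i - (r / s : ℂ) * y j) / (x i - (r * s : ℂ)⁻¹ * y j)) =
      (1 - (s ^ 2 : ℂ)⁻¹) * (s ^ 2 : ℂ) ^ ((1 : ℤ) - n) * Acoef n m (r ^ 2) (s ^ 2) i x y := by
    intro i
    have hx0 := h.x_ne_zero i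
    have e1 : ∀ k, (if ¬k = i then (x i - (s ^ 2 : ℂ)⁻¹ * x k) / (x i - x k) else 1) =
        (if k = i then 1 else (s ^ 2 : ℂ)⁻¹) *
          if ¬k = i then ((s ^ 2 : ℂ) * x i - x k) / (x i - x k) else 1 := by
      intro k
      by_cases hk : k = i
      · simp [hk]
      · simp only [hk, not_false_eq_true, if_true, if_false]
        field_simp
    have e2 : ∀ j, (x i - (r / s : ℂ) * y j) / (x i - (r * s : ℂ)⁻¹ * y j) =
        ((s : ℂ) * x i - r * y j) / (s * x i - (r : ℂ)⁻¹ * y j) := by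
      intro j
      rw [← mul_div_mul_left _ _ cs]
      congr 1 <;> field_simp
    have e3 : ∏ k, (if k = i then 1 else (s ^ 2 : ℂ)⁻¹) = (s ^ 2 : ℂ) ^ ((1 : ℤ) - n) := by
      have hn : 1 ≤ n := (Nat.zero_le i.1).trans_lt i.2
      rw [← mul_prod_erase univ _ (mem_univ i), if_pos rfl, one_mul,
        prod_congr rfl fun k hk => if_neg (ne_of_mem_erase hk), prod_const, card_erase_of_mem
        (mem_univ i), card_univ, Fintype.card_fin, ← zpow_natCast, inv_zpow', Nat.cast_sub hn]
      congr 1; push_cast; ring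
    simp only [e1, e2, prod_mul_distrib, e3, Acoef, Real.sqrt_sq hr.le, Real.sqrt_sq hs.le]
    push_cast
    field_simp
  have hB : ∀ j, ((r * s : ℂ)⁻¹ * y j - (r / s : ℂ) * y j) / ((r * s : ℂ)⁻¹ * y j) * 
      ((∏ i, ((r * s : ℂ)⁻¹ * y j - (s ^ 2 : ℂ)⁻¹ * x i) / ((r * s : ℂ)⁻¹ * y j - x i)) *
      ∏ k, if ¬k = j then ((r * s : ℂ)⁻¹ * y j - (r / s : ℂ) * y k) /
          ((r * s : ℂ)⁻¹ * y j - (r * s : ℂ)⁻¹ * y k) else 1) =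
      (1 - (r ^ 2 : ℂ)) * (r ^ 2 : ℂ) ^ ((m : ℤ) - 1) * Bcoef n m (r ^ 2) (s ^ 2) j x y := by
    intro j
    have hy0 := h.y_ne_zero j
    have e1 : ∀ k, (if ¬k = j then ((r * s : ℂ)⁻¹ * y j - (r / s : ℂ) * y k) /
          ((r * s : ℂ)⁻¹ * y j - (r * s : ℂ)⁻¹ * y k) else 1) =
        (if k = j then 1 else (r ^ 2 : ℂ)) *
          if ¬k = j then ((r ^ 2 : ℂ)⁻¹ * y j - y k) / (y j - y k) else 1 := by
      intro k
      by_cases hk : k = j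
      · simp [hk]
      · simp only [hk, not_false_eq_true, if_true, if_false]
        rw [← mul_sub, ← mul_div_mul_left _ _ (mul_ne_zero cr cs)]
        rw [mul_inv_cancel_left₀ (mul_ne_zero cr cs)]
        field_simp
    have e2 : ∀ i, ((r * s : ℂ)⁻¹ * y j - (s ^ 2 : ℂ)⁻¹ * x i) / ((r * s : ℂ)⁻¹ * y j - x i) =
        ((r : ℂ)⁻¹ * y j - (s : ℂ)⁻¹ * x i) / ((r : ℂ)⁻¹ * y j - s * x i) := by
      intro i
      rw [← mul_div_mul_left _ _ cs]
      congr 1 <;> field_simp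
    have e3 : ∏ k, (if k = j then 1 else (r ^ 2 : ℂ)) = (r ^ 2 : ℂ) ^ ((m : ℤ) - 1) := by
      have hn : 1 ≤ m := (Nat.zero_le j.1).trans_lt j.2
      rw [← mul_prod_erase univ _ (mem_univ j), if_pos rfl, one_mul,
        prod_congr rfl fun k hk => if_neg (ne_of_mem_erase hk), prod_const, card_erase_of_mem
        (mem_univ j), card_univ, Fintype.card_fin, ← zpow_natCast, Nat.cast_sub hn]
      simp
    simp only [e1, e2, prod_mul_distrib, e3, Bcoef, Real.sqrt_sq hr.le, Real.sqrt_sq hs.le]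
    push_cast
    field_simp
  have hC : (∏ i, (s ^ 2 : ℂ)⁻¹ * x i / x i) * ∏ j, (r / s : ℂ) * y j / ((r * s : ℂ)⁻¹ * y j) =
      (s ^ 2 : ℂ)⁻¹ ^ n * (r ^ 2 : ℂ) ^ m := by
    rw [prod_congr rfl fun i _ => mul_div_cancel_right₀ _ (h.x_ne_zero i),
      prod_congr rfl fun j _ => (by
        have := h.y_ne_zero j
        field_simp : (r / s : ℂ) * y j / ((r * s : ℂ)⁻¹ * y j) = r ^ 2)]
    simp
  simp only [hA, hB, hC, ← mul_sum] at hL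
  rw [shiftConst, xCoef, yCoef]
  push_cast
  rw [← hL]
  generalize (s ^ 2 : ℂ)⁻¹ = u at cs1 ⊢
  field_simp

lemma McalOp_eq {n m : ℕ} {q t : ℝ} (hq : 0 < q) (hq1 : q < 1) (ht : 0 < t) (ht1 : t < 1)
    (F : (Fin n → ℂ) → (Fin m → ℂ) → ℂ)
    {x : Fin n → ℂ} {y : Fin m → ℂ} (h : GenericPt q t x y) :
    McalOp n m q t F x y =
      xCoef n q t * ∑ i, Acoef n m q t i x y * F (Function.update x i ((q : ℂ) * x i)) y +
      yCoef m q t * ∑ j, Bcoef n m q t j x y * F x (Function.update y j ((t : ℂ)⁻¹ * y j)) -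
      shiftConst n m q t * F x y := by
  rw [← sum_coef_eq hq hq1 ht ht1 h, McalOp, xCoef, yCoef]
  simp only [mul_sub, sum_sub_distrib, ← sum_mul]
  push_cast
  ring

end Constant

section Polynomial

variable {n m : ℕ}

/-- `F` is given by a polynomial in both sets of variables. -/
def IsPolyFun (F : (Fin n → ℂ) → (Fin m → ℂ) → ℂ) : Prop :=
  ∃ p : MvPolynomial (Fin n ⊕ Fin m) ℂ, ∀ x y, F x y = MvPolynomial.eval (Sum.elim x y) p

namespace IsPolyFun

variable {F G : (Fin n → ℂ) → (Fin m → ℂ) → ℂ}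

lemma const (c : ℂ) : IsPolyFun fun (_ : Fin n → ℂ) (_ : Fin m → ℂ) => c :=
  ⟨MvPolynomial.C c, fun x y => by simp⟩

lemma fst (i : Fin n) : IsPolyFun fun (x : Fin n → ℂ) (_ : Fin m → ℂ) => x i :=
  ⟨MvPolynomial.X (Sum.inl i), fun x y => by simp⟩

lemma snd (j : Fin m) : IsPolyFun fun (_ : Fin n → ℂ) (y : Fin m → ℂ) => y j :=
  ⟨MvPolynomial.X (Sum.inr j), fun x y => by simp⟩

lemma add (hF : IsPolyFun F) (hG : IsPolyFun G) : IsPolyFun fun x y => F x y + G x y := by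
  obtain ⟨p, hp⟩ := hF
  obtain ⟨p', hp'⟩ := hG
  exact ⟨p + p', fun x y => by simp [hp, hp']⟩

lemma sub (hF : IsPolyFun F) (hG : IsPolyFun G) : IsPolyFun fun x y => F x y - G x y := by
  obtain ⟨p, hp⟩ := hF
  obtain ⟨p', hp'⟩ := hG
  exact ⟨p - p', fun x y => by simp [hp, hp']⟩

lemma mul (hF : IsPolyFun F) (hG : IsPolyFun G) : IsPolyFun fun x y => F x y * G x y := by
  obtain ⟨p, hp⟩ := hF
  obtain ⟨p', hp'⟩ := hG
  exact ⟨p * p', fun x y => by simp [hp, hp']⟩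

lemma sum {ι : Type*} {s : Finset ι} {F : ι → (Fin n → ℂ) → (Fin m → ℂ) → ℂ}
    (hF : ∀ k, IsPolyFun (F k)) : IsPolyFun fun x y => ∑ k ∈ s, F k x y := by
  choose p hp using hF
  exact ⟨∑ k ∈ s, p k, fun x y => by simp [hp]⟩

lemma prod {ι : Type*} {s : Finset ι} {F : ι → (Fin n → ℂ) → (Fin m → ℂ) → ℂ}
    (hF : ∀ k, IsPolyFun (F k)) : IsPolyFun fun x y => ∏ k ∈ s, F k x y := by
  choose p hp using hF
  exact ⟨∏ k ∈ s, p k, fun x y => by simp [hp]⟩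

lemma ite {c : Prop} [Decidable c] (hF : IsPolyFun F) (hG : IsPolyFun G) :
    IsPolyFun fun x y => if c then F x y else G x y := by
  split_ifs
  exacts [hF, hG]

lemma comp {k l : ℕ} (hF : IsPolyFun F) {X : Fin n → (Fin k → ℂ) → (Fin l → ℂ) → ℂ}
    {Y : Fin m → (Fin k → ℂ) → (Fin l → ℂ) → ℂ} (hX : ∀ i, IsPolyFun (X i))
    (hY : ∀ j, IsPolyFun (Y j)) :
    IsPolyFun fun x y => F (fun i => X i x y) (fun j => Y j x y) := by
  obtain ⟨p, hp⟩ := hF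
  choose a ha using hX
  choose b hb using hY
  refine ⟨MvPolynomial.bind₁ (Sum.elim a b) p, fun x y => ?_⟩
  beta_reduce
  rw [hp, MvPolynomial.eval, MvPolynomial.eval, MvPolynomial.eval₂Hom_bind₁]
  congr 2
  funext k
  rcases k with k | k
  · exact ha k x y
  · exact hb k x y

lemma update_fst (hF : IsPolyFun F) (i : Fin n) {c : (Fin n → ℂ) → (Fin m → ℂ) → ℂ}
    (hc : IsPolyFun c) : IsPolyFun fun x y => F (Function.update x i (c x y)) y := by
  refine hF.comp (fun k => ?_) fun j => snd j
  simp only [Function.update_apply]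
  exact ite hc (fst k)

lemma update_snd (hF : IsPolyFun F) (j : Fin m) {c : (Fin n → ℂ) → (Fin m → ℂ) → ℂ}
    (hc : IsPolyFun c) : IsPolyFun fun x y => F x (Function.update y j (c x y)) := by
  refine hF.comp (fun i => fst i) fun k => ?_
  simp only [Function.update_apply]
  exact ite hc (snd k)

lemma eq_zero_of_mul (hF : IsPolyFun F) (hG : IsPolyFun G) (h : ∀ x y, F x y * G x y = 0)
    (hne : ∃ x y, F x y ≠ 0) (x : Fin n → ℂ) (y : Fin m → ℂ) : G x y = 0 := by
  obtain ⟨p, hp⟩ := hF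
  obtain ⟨p', hp'⟩ := hG
  have h1 : p * p' = 0 := MvPolynomial.funext fun z => by
    have := h (z ∘ Sum.inl) (z ∘ Sum.inr)
    rw [hp, hp', Sum.elim_comp_inl_inr] at this
    simpa using this
  rcases mul_eq_zero.1 h1 with h2 | h2
  · obtain ⟨x, y, hxy⟩ := hne
    exact absurd (by rw [hp, h2, map_zero]) hxy
  · rw [hp', h2, map_zero]

lemma eq_zero_of_prod_mul {ι : Type*} (s : Finset ι) {F : ι → (Fin n → ℂ) → (Fin m → ℂ) → ℂ}
    (hF : ∀ k, IsPolyFun (F k)) (hG : IsPolyFun G) (h : ∀ x y, (∏ k ∈ s, F k x y) * G x y = 0)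
    (hne : ∀ k ∈ s, ∃ x y, F k x y ≠ 0) (x : Fin n → ℂ) (y : Fin m → ℂ) : G x y = 0 := by
  classical
  induction s using Finset.induction_on with
  | empty => simpa using h x y
  | insert a s ha ih =>
    refine ih (fun x y => ?_) fun k hk => hne k (mem_insert_of_mem hk)
    refine eq_zero_of_mul (G := fun x y => (∏ k ∈ s, F k x y) * G x y) (hF a)
      ((prod hF).mul hG) (fun x y => ?_) (hne a (mem_insert_self a s)) x y
    have h1 := h x y
    rwa [prod_insert ha, mul_assoc] at h1

lemma eq_zero_of_generic {q t : ℝ} (hq : 0 < q) (ht : 0 < t) (hF : IsPolyFun F)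
    (h : ∀ x y, GenericPt q t x y → F x y = 0) (x : Fin n → ℂ) (y : Fin m → ℂ) : F x y = 0 := by
  let E : (Fin n → ℂ) → (Fin m → ℂ) → ℂ := fun x y =>
    (∏ i, x i) * (∏ j, y j) * (∏ i, ∏ k, if i ≠ k then x i - x k else 1) *
      (∏ j, ∏ l, if j ≠ l then y j - y l else 1) *
      (∏ i, ∏ j, ((Real.sqrt q : ℂ) * (Real.sqrt t : ℂ) * x i - y j)) *
      ∏ i, ∏ j, (x i - (Real.sqrt q : ℂ) * (Real.sqrt t : ℂ) * y j)
  have hE : IsPolyFun E := by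
    refine ((((((prod fst).mul (prod snd)).mul (prod fun i => prod fun k =>
      ((fst i).sub (fst k)).ite (const 1))).mul (prod fun i => prod fun k =>
      ((snd i).sub (snd k)).ite (const 1))).mul (prod fun i => prod fun k =>
      ((const _).mul (fst i)).sub (snd k))).mul (prod fun i => prod fun k =>
      (fst i).sub ((const _).mul (snd k))))
  have hgen : ∀ x y, GenericPt q t x y ↔ E x y ≠ 0 := by
    intro x y
    simp only [E, mul_ne_zero_iff, prod_ne_zero_iff, mem_univ, true_imp_iff, sub_ne_zero]
    constructor
    · intro h
      refine ⟨⟨⟨⟨⟨h.x_ne_zero, h.y_ne_zero⟩, fun i k => ?_⟩, fun i k => ?_⟩, h.mul_x_ne⟩, h.x_ne_mul⟩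
      · split_ifs with hik
        exacts [sub_ne_zero.2 (h.x_ne i k hik), one_ne_zero]
      · split_ifs with hik
        exacts [sub_ne_zero.2 (h.y_ne i k hik), one_ne_zero]
    · rintro ⟨⟨⟨⟨⟨h1, h2⟩, h3⟩, h4⟩, h5⟩, h6⟩
      refine ⟨h1, h2, fun i k hik => ?_, fun i k hik => ?_, h5, h6⟩
      · simpa [hik, sub_eq_zero] using h3 i k
      · simpa [hik, sub_eq_zero] using h4 i k
  refine eq_zero_of_mul hE hF (fun x y => ?_) ?_ x y
  · by_cases hxy : E x y = 0
    · rw [hxy, zero_mul]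
    · rw [h x y ((hgen x y).2 hxy), mul_zero]
  · obtain ⟨w, hw⟩ := (ae_genericPt (n := n) (m := m) hq ht one_pos one_pos).exists
    exact ⟨_, _, (hgen _ _).1 hw⟩

lemma exists_sub_eq_mul (hF : IsPolyFun F) (a : Fin n) (b : Fin m) (c : ℂ) :
    ∃ G : (Fin n → ℂ) → (Fin m → ℂ) → ℂ, IsPolyFun G ∧ ∀ x y,
      F x y - F x (Function.update y b (c * x a)) = (c * x a - y b) * G x y := by
  obtain ⟨p, hp⟩ := hF
  induction p using MvPolynomial.induction_on generalizing F with
  | C d => exact ⟨_, const 0, fun x y => by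
    rw [hp, hp, MvPolynomial.eval_C, MvPolynomial.eval_C, sub_self, mul_zero]⟩
  | add p p' ih ih' =>
    obtain ⟨G, hG, h⟩ := ih (F := fun x y => MvPolynomial.eval (Sum.elim x y) p) fun _ _ => rfl
    obtain ⟨G', hG', h'⟩ := ih' (F := fun x y => MvPolynomial.eval (Sum.elim x y) p')
      fun _ _ => rfl
    refine ⟨_, hG.add hG', fun x y => ?_⟩
    rw [hp, hp, map_add, map_add]
    linear_combination h x y + h' x y
  | mul_X p k ih =>
    obtain ⟨G, hG, h⟩ := ih (F := fun x y => MvPolynomial.eval (Sum.elim x y) p) fun _ _ => rfl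
    have hP : IsPolyFun (n := n) (m := m) fun x y => MvPolynomial.eval (Sum.elim x y) p :=
      ⟨p, fun _ _ => rfl⟩
    rcases k with i | j
    · refine ⟨_, hG.mul (fst i), fun x y => ?_⟩
      simp only [hp, map_mul, MvPolynomial.eval_X, Sum.elim_inl]
      linear_combination x i * h x y
    · refine ⟨_, (hG.mul (snd j)).add ((hP.update_snd b ((const c).mul (fst a))).mul
        (const (if j = b then -1 else 0))), fun x y => ?_⟩
      simp only [hp, map_mul, MvPolynomial.eval_X, Sum.elim_inr, Function.update_apply y b _ j]
      split_ifs with hj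
      · subst hj
        linear_combination y j * h x y
      · linear_combination y j * h x y

lemma exists_eq_prod_mul (hF : IsPolyFun F) {α β : ℂ} (hα : α ≠ 0) (hβ : β ≠ 0)
    (h : ∀ i j x y, α * x i - β * y j = 0 → F x y = 0) :
    ∃ G : (Fin n → ℂ) → (Fin m → ℂ) → ℂ, IsPolyFun G ∧ ∀ x y,
      F x y = (∏ i, ∏ j, (α * x i - β * y j)) * G x y := by
  have hl : ∀ k : Fin n × Fin m, IsPolyFun fun (x : Fin n → ℂ) (y : Fin m → ℂ) =>
    α * x k.1 - β * y k.2 := fun k => ((const α).mul (fst _)).sub ((const β).mul (snd _))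
  suffices H : ∀ T : Finset (Fin n × Fin m), ∃ G : (Fin n → ℂ) → (Fin m → ℂ) → ℂ, IsPolyFun G ∧
      ∀ x y, F x y = (∏ k ∈ T, (α * x k.1 - β * y k.2)) * G x y by
    obtain ⟨G, hG, hFG⟩ := H univ
    refine ⟨G, hG, fun x y => ?_⟩
    rw [hFG, ← univ_product_univ, prod_product]
  intro T
  classical
  induction T using Finset.induction_on with
  | empty => exact ⟨F, hF, fun x y => by simp⟩
  | insert k T hk ih =>
    obtain ⟨G, hG, hFG⟩ := ih
    obtain ⟨a, b⟩ := k
    have hc : IsPolyFun fun (x : Fin n → ℂ) (_ : Fin m → ℂ) => α / β * x a :=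
      (const _).mul (fst a)
    have h0 : ∀ x y, G x (Function.update y b (α / β * x a)) = 0 := by
      refine eq_zero_of_prod_mul T (fun k => (hl k).update_snd b hc) (hG.update_snd b hc)
        (fun x y => ?_) ?_
      · rw [← hFG]
        refine h a b _ _ ?_
        rw [Function.update_self]
        field_simp
        ring
      · rintro ⟨i, j⟩ hij
        by_cases hj : j = b
        · subst hj
          have hia : i ≠ a := fun hia => hk (hia ▸ hij)
          refine ⟨Pi.single i 1, 0, ?_⟩
          simp [hia.symm, hα]
        · refine ⟨0, Pi.single j 1, ?_⟩
          simp [hj, hβ]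
    obtain ⟨G', hG', hGG'⟩ := hG.exists_sub_eq_mul a b (α / β)
    refine ⟨_, hG'.mul (const β⁻¹), fun x y => ?_⟩
    have h1 := hGG' x y
    rw [h0, sub_zero] at h1
    rw [prod_insert hk, hFG, h1]
    field_simp

lemma diffAt₂ (hF : IsPolyFun F) (x : Fin n → ℂ) (y : Fin m → ℂ) : DiffAt₂ F x y := by
  obtain ⟨p, hp⟩ := hF
  have h := AnalyticOnNhd.eval_mvPolynomial (𝕜 := ℂ) p (Sum.elim x y) (Set.mem_univ _)
  have h1 : (fun z : (Fin n → ℂ) × (Fin m → ℂ) => F z.1 z.2) =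
      (fun z => MvPolynomial.eval z p) ∘ fun z => Sum.elim z.1 z.2 := by
    funext z
    exact hp _ _
  rw [DiffAt₂, h1]
  refine DifferentiableAt.comp (x, y) h.differentiableAt ?_
  rw [differentiableAt_pi]
  rintro (i | j)
  · exact differentiableAt_pi.1 differentiableAt_fst i
  · exact differentiableAt_pi.1 differentiableAt_snd j

end IsPolyFun

end Polynomial

section Regularization

variable {n m : ℕ} {q t : ℝ}

namespace DiffAt₂

variable {F G : (Fin n → ℂ) → (Fin m → ℂ) → ℂ} {x : Fin n → ℂ} {y : Fin m → ℂ}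

lemma mul (hF : DiffAt₂ F x y) (hG : DiffAt₂ G x y) :
    DiffAt₂ (fun x y => F x y * G x y) x y := by
  have hF' : DifferentiableAt ℂ (fun z : (Fin n → ℂ) × (Fin m → ℂ) => F z.1 z.2) (x, y) := hF
  have hG' : DifferentiableAt ℂ (fun z : (Fin n → ℂ) × (Fin m → ℂ) => G z.1 z.2) (x, y) := hG
  exact hF'.mul hG'

lemma div (hF : DiffAt₂ F x y) (hG : DiffAt₂ G x y) (h : G x y ≠ 0) :
    DiffAt₂ (fun x y => F x y / G x y) x y := by
  have hF' : DifferentiableAt ℂ (fun z : (Fin n → ℂ) × (Fin m → ℂ) => F z.1 z.2) (x, y) := hF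
  have hG' : DifferentiableAt ℂ (fun z : (Fin n → ℂ) × (Fin m → ℂ) => G z.1 z.2) (x, y) := hG
  simpa only [div_eq_mul_inv] using! hF'.mul (hG'.fun_inv h)

lemma const (c : ℂ) : DiffAt₂ (fun _ _ => c) x y :=
  differentiableAt_const c

lemma prod {ι : Type*} {s : Finset ι} {F : ι → (Fin n → ℂ) → (Fin m → ℂ) → ℂ}
    (hF : ∀ k, DiffAt₂ (F k) x y) : DiffAt₂ (fun x y => ∏ k ∈ s, F k x y) x y := by
  classical
  induction s using Finset.induction_on with
  | empty => simpa using! const 1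
  | insert a s ha ih =>
    simp only [prod_insert ha]
    exact (hF a).mul ih

end DiffAt₂

lemma prod_prod_row_ite {ι κ : Type*} [Fintype ι] [Fintype κ] [DecidableEq ι] (i : ι)
    (f g : ι → κ → ℂ) (hg : ∀ b, g i b ≠ 0) :
    (∏ a, ∏ b, if a = i then f a b else g a b) = (∏ a, ∏ b, g a b) * ∏ b, f i b / g i b := by
  rw [← mul_prod_erase univ (fun a => ∏ b, if a = i then f a b else g a b) (mem_univ i),
    ← mul_prod_erase univ (fun a => ∏ b, g a b) (mem_univ i), prod_div_distrib]
  have h1 : ∏ a ∈ univ.erase i, ∏ b, (if a = i then f a b else g a b) =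
      ∏ a ∈ univ.erase i, ∏ b, g a b :=
    prod_congr rfl fun a ha => prod_congr rfl fun b _ => if_neg (ne_of_mem_erase ha)
  have h2 : ∏ b, g i b ≠ 0 := prod_ne_zero_iff.2 fun b _ => hg b
  rw [h1]
  simp only [if_true]
  field_simp

/-- The product of all differences of distinct coordinates. -/
def diffProd (x : Fin n → ℂ) : ℂ := ∏ a, ∏ b, if b ≠ a then x a - x b else 1

/-- The factor on the zero set of which elements of `Λ` satisfy their symmetry condition. -/
def mixedFactor (q t : ℝ) (x : Fin n → ℂ) (y : Fin m → ℂ) (a : Fin n) (b : Fin m) : ℂ :=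
  (Real.sqrt t : ℂ) * x a - (Real.sqrt q : ℂ)⁻¹ * y b

/-- A common denominator of all the coefficients of the shift operators. -/
def commonDenom (q t : ℝ) (x : Fin n → ℂ) (y : Fin m → ℂ) : ℂ :=
  diffProd x * diffProd y * ∏ a, ∏ b, mixedFactor q t x y a b

/-- The coefficient of the `i`-th `x`-shift multiplied by the common denominator. -/
def clearedA (q t : ℝ) (i : Fin n) (x : Fin n → ℂ) (y : Fin m → ℂ) : ℂ :=
  (∏ a, ∏ b, if a = i then (if b ≠ a then (t : ℂ) * x a - x b else 1)
    else if b ≠ a then x a - x b else 1) * diffProd y *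
  ∏ a, ∏ b, if a = i then (Real.sqrt t : ℂ) * x a - (Real.sqrt q : ℂ) * y b
    else mixedFactor q t x y a b

/-- The coefficient of the `j`-th `y`-shift multiplied by the common denominator. -/
def clearedB (q t : ℝ) (j : Fin m) (x : Fin n → ℂ) (y : Fin m → ℂ) : ℂ :=
  diffProd x * (∏ a, ∏ b, if a = j then (if b ≠ a then (q : ℂ)⁻¹ * y a - y b else 1)
    else if b ≠ a then y a - y b else 1) *
  ∏ a, ∏ b, if a = j then (Real.sqrt t : ℂ)⁻¹ * x b - (Real.sqrt q : ℂ)⁻¹ * y a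
    else mixedFactor q t x y b a

lemma GenericPt.mixedFactor_ne_zero (hq : 0 < q) {x : Fin n → ℂ} {y : Fin m → ℂ}
    (h : GenericPt q t x y) (a : Fin n) (b : Fin m) : mixedFactor q t x y a b ≠ 0 := by
  have cq : (Real.sqrt q : ℂ) ≠ 0 := by exact_mod_cast (Real.sqrt_pos.2 hq).ne'
  intro h0
  refine h.mul_x_ne a b ?_
  rw [mixedFactor, sub_eq_zero] at h0
  rw [mul_assoc, h0, mul_inv_cancel_left₀ cq]

lemma ite_sub_ne_zero {x : Fin n → ℂ} (h : ∀ i k, i ≠ k → x i ≠ x k) (a b : Fin n) :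
    (if b ≠ a then x a - x b else 1) ≠ 0 := by
  split_ifs with hab
  · exact sub_ne_zero.2 (h a b hab.symm)
  · exact one_ne_zero

lemma ite_one_div_ite_one {c : Prop} [Decidable c] (u v : ℂ) :
    (if c then u else 1) / (if c then v else 1) = if c then u / v else 1 := by
  split_ifs <;> simp

lemma clearedA_eq (hq : 0 < q) {x : Fin n → ℂ} {y : Fin m → ℂ} (h : GenericPt q t x y)
    (i : Fin n) : clearedA q t i x y = commonDenom q t x y * Acoef n m q t i x y := by
  rw [clearedA, prod_prod_row_ite i _ _ (ite_sub_ne_zero h.x_ne i),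
    prod_prod_row_ite i _ _ (h.mixedFactor_ne_zero hq i), commonDenom, Acoef]
  simp only [ite_one_div_ite_one, mixedFactor, diffProd]
  ring

lemma clearedB_eq (hq : 0 < q) {x : Fin n → ℂ} {y : Fin m → ℂ} (h : GenericPt q t x y)
    (j : Fin m) : clearedB q t j x y = commonDenom q t x y * Bcoef n m q t j x y := by
  rw [clearedB, prod_prod_row_ite j _ _ (ite_sub_ne_zero h.y_ne j),
    prod_prod_row_ite j _ (fun a b => mixedFactor q t x y b a)
      (fun i => h.mixedFactor_ne_zero hq i j), commonDenom, Bcoef,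
    prod_comm (f := fun a b => mixedFactor q t x y a b)]
  have h1 : ∀ i, ((Real.sqrt q : ℂ)⁻¹ * y j - (Real.sqrt t : ℂ)⁻¹ * x i) /
      ((Real.sqrt q : ℂ)⁻¹ * y j - (Real.sqrt t : ℂ) * x i) =
      ((Real.sqrt t : ℂ)⁻¹ * x i - (Real.sqrt q : ℂ)⁻¹ * y j) /
      ((Real.sqrt t : ℂ) * x i - (Real.sqrt q : ℂ)⁻¹ * y j) := fun i => by
    rw [← neg_div_neg_eq, neg_sub, neg_sub]
  simp only [ite_one_div_ite_one, mixedFactor, h1, diffProd]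
  ring

lemma isPolyFun_diffProd_fst : IsPolyFun fun (x : Fin n → ℂ) (_ : Fin m → ℂ) => diffProd x :=
  .prod fun a => .prod fun b => ((IsPolyFun.fst a).sub (.fst b)).ite (.const 1)

lemma isPolyFun_diffProd_snd : IsPolyFun fun (_ : Fin n → ℂ) (y : Fin m → ℂ) => diffProd y :=
  .prod fun a => .prod fun b => ((IsPolyFun.snd a).sub (.snd b)).ite (.const 1)

lemma isPolyFun_mixedFactor (a : Fin n) (b : Fin m) :
    IsPolyFun fun x y => mixedFactor q t x y a b :=
  ((IsPolyFun.const _).mul (.fst a)).sub ((IsPolyFun.const _).mul (.snd b))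

lemma isPolyFun_commonDenom :
    IsPolyFun fun (x : Fin n → ℂ) (y : Fin m → ℂ) => commonDenom q t x y :=
  (isPolyFun_diffProd_fst.mul isPolyFun_diffProd_snd).mul
    (.prod fun a => .prod fun b => isPolyFun_mixedFactor a b)

lemma isPolyFun_clearedA (i : Fin n) :
    IsPolyFun fun (x : Fin n → ℂ) (y : Fin m → ℂ) => clearedA q t i x y :=
  ((IsPolyFun.prod fun a => .prod fun b =>
    ((((IsPolyFun.const _).mul (.fst a)).sub (.fst b)).ite (.const 1)).ite
      (((IsPolyFun.fst a).sub (.fst b)).ite (.const 1))).mul isPolyFun_diffProd_snd).mul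
    (.prod fun a => .prod fun b => .ite
      (((IsPolyFun.const _).mul (.fst a)).sub ((IsPolyFun.const _).mul (.snd b)))
      (isPolyFun_mixedFactor a b))

lemma isPolyFun_clearedB (j : Fin m) :
    IsPolyFun fun (x : Fin n → ℂ) (y : Fin m → ℂ) => clearedB q t j x y :=
  (isPolyFun_diffProd_fst.mul (IsPolyFun.prod fun a => .prod fun b =>
    ((((IsPolyFun.const _).mul (.snd a)).sub (.snd b)).ite (.const 1)).ite
      (((IsPolyFun.snd a).sub (.snd b)).ite (.const 1)))).mul
    (.prod fun a => .prod fun b => .ite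
      (((IsPolyFun.const _).mul (.fst b)).sub ((IsPolyFun.const _).mul (.snd a)))
      (isPolyFun_mixedFactor b a))

lemma sum_cleared_eq (hq : 0 < q) (hq1 : q < 1) (ht : 0 < t) (ht1 : t < 1)
    (x : Fin n → ℂ) (y : Fin m → ℂ) :
    xCoef n q t * ∑ i, clearedA q t i x y + yCoef m q t * ∑ j, clearedB q t j x y =
      shiftConst n m q t * commonDenom q t x y := by
  refine sub_eq_zero.1 (IsPolyFun.eq_zero_of_generic (F := fun x y =>
    xCoef n q t * ∑ i, clearedA q t i x y + yCoef m q t * ∑ j, clearedB q t j x y -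
      shiftConst n m q t * commonDenom q t x y) hq ht ?_ ?_ x y)
  · exact (((IsPolyFun.const _).mul (.sum fun i => isPolyFun_clearedA i)).add
      ((IsPolyFun.const _).mul (.sum fun j => isPolyFun_clearedB j))).sub
      ((IsPolyFun.const _).mul isPolyFun_commonDenom)
  · intro x y h
    simp only [clearedA_eq hq h, clearedB_eq hq h, ← mul_sum]
    linear_combination commonDenom q t x y * sum_coef_eq hq hq1 ht ht1 h

lemma clearedA_eq_zero {i k : Fin n} (hk : k ≠ i) (j : Fin m) {x : Fin n → ℂ} {y : Fin m → ℂ}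
    (h : mixedFactor q t x y i j = 0) : clearedA q t k x y = 0 := by
  rw [clearedA, mul_eq_zero]
  refine .inr (prod_eq_zero (mem_univ i) (prod_eq_zero (mem_univ j) ?_))
  rw [if_neg hk.symm, h]

lemma clearedB_eq_zero {j k : Fin m} (hk : k ≠ j) (i : Fin n) {x : Fin n → ℂ} {y : Fin m → ℂ}
    (h : mixedFactor q t x y i j = 0) : clearedB q t k x y = 0 := by
  rw [clearedB, mul_eq_zero]
  refine .inr (prod_eq_zero (mem_univ j) (prod_eq_zero (mem_univ i) ?_))
  rw [if_neg hk.symm, h]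

/-- The operator applied to an element of `Λ` has no poles off the diagonals. -/
lemma exists_diffProd_mul_McalOp (hq : 0 < q) (hq1 : q < 1) (ht : 0 < t) (ht1 : t < 1)
    {P : (Fin n → ℂ) → (Fin m → ℂ) → ℂ} (hP : InLambda n m q t P) :
    ∃ G : (Fin n → ℂ) → (Fin m → ℂ) → ℂ, IsPolyFun G ∧ ∀ x y, GenericPt q t x y →
      diffProd x * diffProd y * McalOp n m q t P x y = G x y := by
  have cq : (Real.sqrt q : ℂ) ≠ 0 := by exact_mod_cast (Real.sqrt_pos.2 hq).ne'
  have ct : (Real.sqrt t : ℂ) ≠ 0 := by exact_mod_cast (Real.sqrt_pos.2 ht).ne'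
  have hp : IsPolyFun P := hP.1
  let N : (Fin n → ℂ) → (Fin m → ℂ) → ℂ := fun x y =>
    xCoef n q t * ∑ i, clearedA q t i x y *
      (P (Function.update x i ((q : ℂ) * x i)) y - P x y) +
    yCoef m q t * ∑ j, clearedB q t j x y *
      (P x (Function.update y j ((t : ℂ)⁻¹ * y j)) - P x y)
  have hN : IsPolyFun N := by
    refine ((IsPolyFun.const _).mul (.sum fun i => (isPolyFun_clearedA i).mul
      ((hp.update_fst i ((IsPolyFun.const _).mul (.fst i))).sub hp))).add
      ((IsPolyFun.const _).mul (.sum fun j => (isPolyFun_clearedB j).mul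
      ((hp.update_snd j ((IsPolyFun.const _).mul (.snd j))).sub hp)))
  obtain ⟨G, hG, hNG⟩ := hN.exists_eq_prod_mul ct (inv_ne_zero cq) (by
    intro i j x y hij
    have hm : mixedFactor q t x y i j = 0 := hij
    have hT := hP.2.2 i j x y (by
      rw [sub_eq_zero] at hij
      field_simp at hij ⊢
      linear_combination hij)
    have h1 := sum_cleared_eq hq hq1 ht ht1 x y
    have h2 : commonDenom q t x y = 0 := by
      rw [commonDenom, mul_eq_zero]
      exact .inr (prod_eq_zero (mem_univ i) (prod_eq_zero (mem_univ j) hm))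
    rw [h2, mul_zero, sum_eq_single i (fun k _ hk => clearedA_eq_zero hk j hm) (by simp),
      sum_eq_single j (fun k _ hk => clearedB_eq_zero hk i hm) (by simp)] at h1
    simp only [N]
    rw [sum_eq_single i (fun k _ hk => by rw [clearedA_eq_zero hk j hm, zero_mul]) (by simp),
      sum_eq_single j (fun k _ hk => by rw [clearedB_eq_zero hk i hm, zero_mul]) (by simp), hT]
    linear_combination (P x (Function.update y j ((t : ℂ)⁻¹ * y j)) - P x y) * h1)
  refine ⟨G, hG, fun x y h => ?_⟩
  have h1 : ∏ a, ∏ b, mixedFactor q t x y a b ≠ 0 :=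
    prod_ne_zero_iff.2 fun a _ => prod_ne_zero_iff.2 fun b _ => h.mixedFactor_ne_zero hq a b
  refine mul_left_cancel₀ h1 ((?_ : _ = N x y).trans (hNG x y))
  simp only [N, clearedA_eq hq h, clearedB_eq hq h, McalOp, xCoef, yCoef, mul_assoc, ← mul_sum]
  rw [commonDenom]
  push_cast
  ring

/-- The product of all the factors `1 - x i / x k` with `i ≠ k`. -/
def ratioProd (x : Fin n → ℂ) : ℂ := ∏ i, ∏ k, if i ≠ k then 1 - x i / x k else 1

lemma ratioProd_mul {x : Fin n → ℂ} (hx : ∀ i, x i ≠ 0) :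
    ratioProd x * (∏ i, ∏ k, if k ≠ i then x i else 1) = diffProd x := by
  rw [ratioProd, prod_comm, ← prod_mul_distrib, diffProd]
  refine prod_congr rfl fun i _ => ?_
  rw [← prod_mul_distrib]
  refine prod_congr rfl fun k _ => ?_
  split_ifs with h
  · rw [sub_mul, div_mul_cancel₀ _ (hx i), one_mul]
  · rw [one_mul]

lemma exists_ratioProd_mul_McalOp (hq : 0 < q) (hq1 : q < 1) (ht : 0 < t) (ht1 : t < 1)
    {P : (Fin n → ℂ) → (Fin m → ℂ) → ℂ} (hP : InLambda n m q t P) :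
    ∃ H : (Fin n → ℂ) → (Fin m → ℂ) → ℂ,
      (∀ x y, (∀ i, x i ≠ 0) → (∀ j, y j ≠ 0) → DiffAt₂ H x y) ∧
      ∀ x y, GenericPt q t x y →
        ratioProd x * ratioProd y * McalOp n m q t P x y = H x y := by
  obtain ⟨G, hG, h⟩ := exists_diffProd_mul_McalOp hq hq1 ht ht1 hP
  let E : (Fin n → ℂ) → (Fin m → ℂ) → ℂ := fun x y =>
    (∏ i, ∏ k, if k ≠ i then x i else 1) * ∏ i, ∏ k, if k ≠ i then y i else 1
  have hE : IsPolyFun E := by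
    refine (IsPolyFun.prod fun i => .prod fun k => ?_).mul (IsPolyFun.prod fun i => .prod fun k => ?_)
    · exact (IsPolyFun.fst i).ite (.const 1)
    · exact (IsPolyFun.snd i).ite (.const 1)
  have hE0 : ∀ x y, (∀ i, x i ≠ 0) → (∀ j, y j ≠ 0) → E x y ≠ 0 := by
    intro x y hx hy
    refine mul_ne_zero ?_ ?_ <;>
      refine prod_ne_zero_iff.2 fun a _ => prod_ne_zero_iff.2 fun b _ => ?_ <;> split_ifs
    exacts [hx a, one_ne_zero, hy a, one_ne_zero]
  refine ⟨fun x y => G x y / E x y, fun x y hx hy => ?_, fun x y hxy => ?_⟩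
  · exact (hG.diffAt₂ x y).div (hE.diffAt₂ x y) (hE0 x y hx hy)
  · beta_reduce
    rw [← h x y hxy, eq_div_iff (hE0 x y hxy.x_ne_zero hxy.y_ne_zero),
      ← ratioProd_mul hxy.x_ne_zero, ← ratioProd_mul hxy.y_ne_zero]
    simp only [E]
    ring

/-- Differentiability at all points with nonzero coordinates passes to the conjugate function. -/
lemma diffAt₂_starFun {F : (Fin n → ℂ) → (Fin m → ℂ) → ℂ}
    (hF : ∀ x y, (∀ i, x i ≠ 0) → (∀ j, y j ≠ 0) → DiffAt₂ F x y)
    {x : Fin n → ℂ} {y : Fin m → ℂ} (hx : ∀ i, x i ≠ 0) (hy : ∀ j, y j ≠ 0) :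
    DiffAt₂ (starFun F) x y := by
  let f : (Fin n → ℂ) × (Fin m → ℂ) → ℂ := fun z => F z.1 z.2
  have h1 : DifferentiableAt ℂ (star ∘ f ∘ star) (x⁻¹, y⁻¹) := by
    have h0 : DifferentiableAt ℂ f (star (x⁻¹, y⁻¹)) :=
      hF _ _ (fun i => by simpa using hx i) fun j => by simpa using hy j
    simpa only [star_star] using h0.star_star
  have h2 : DifferentiableAt ℂ (fun z : (Fin n → ℂ) × (Fin m → ℂ) => (z.1⁻¹, z.2⁻¹)) (x, y) := by
    refine DifferentiableAt.prodMk ?_ ?_ <;> rw [differentiableAt_pi] <;> intro k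
    · exact (differentiableAt_pi.1 differentiableAt_fst k).fun_inv (hx k)
    · exact (differentiableAt_pi.1 differentiableAt_snd k).fun_inv (hy k)
  have h3 := DifferentiableAt.comp (x, y) h1 h2
  refine h3.congr_of_eventuallyEq (.of_forall fun z => ?_)
  simp only [starFun, f, Function.comp_apply]
  rw [starRingEnd_apply]
  congr 2 <;> funext i <;> simp

end Regularization

section Weight

variable {n m : ℕ} {q t : ℝ}

/-- A product of quotients of `q`-Pochhammer symbols over ordered pairs of distinct indices. -/
def weightProd (q : ℂ) (a b : Fin n → ℂ) (x : Fin n → ℂ) : ℂ :=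
  ∏ i, ∏ j, if i ≠ j then
    qPochInf (a i * (x i / x j)) q / qPochInf (b i * (x i / x j)) q else 1

/-- The constant `q^{-1/2} t^{1/2}`. -/
def mixConst (q t : ℝ) : ℂ := (Real.sqrt q : ℂ)⁻¹ * (Real.sqrt t : ℂ)

/-- A product over pairs of an `x`-variable and a `y`-variable. -/
def mixedWeight (p a b : Fin n → ℂ) (x : Fin n → ℂ) (y : Fin m → ℂ) : ℂ :=
  ∏ i, ∏ j, p i / ((1 - a i * (x i / y j)) * (1 - b i * (y j / x i)))

/-- The weight function divided by its zeros on the diagonals. -/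
def regDelta (q t : ℝ) (x : Fin n → ℂ) (y : Fin m → ℂ) : ℂ :=
  weightProd q (fun _ => q) (fun _ => t) x * weightProd t (fun _ => t) (fun _ => q) y *
    mixedWeight 1 (fun _ => mixConst q t) (fun _ => mixConst q t) x y

/-- The weight function multiplied by the coefficient of the `i`-th shift operator. -/
def shiftWeight (q t : ℝ) (i : Fin n) (x : Fin n → ℂ) (y : Fin m → ℂ) : ℂ :=
  weightProd q (fun k => if k = i then q else 1) (fun k => t * if k = i then (q : ℂ) else 1) x *
    DeltaW t q y * mixedWeight (fun k => if k = i then q else 1)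
      (fun k => mixConst q t * if k = i then (q : ℂ) else 1) (fun _ => mixConst q t) x y

lemma DeltaW_eq_weightProd {q t : ℂ} (x : Fin n → ℂ) :
    DeltaW q t x = weightProd q (fun _ => 1) (fun _ => t) x := by
  simp [DeltaW, weightProd]

lemma DeltaNM_eq (x : Fin n → ℂ) (y : Fin m → ℂ) :
    DeltaNM n m q t x y = DeltaW q t x * DeltaW t q y *
      mixedWeight 1 (fun _ => mixConst q t) (fun _ => mixConst q t) x y := by
  rw [DeltaNM, div_eq_mul_inv, ← prod_inv_distrib]
  congr 1
  refine prod_congr rfl fun i _ => ?_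
  rw [← prod_inv_distrib]
  refine prod_congr rfl fun j _ => ?_
  rw [Pi.one_apply, one_div, mixConst]

lemma ratioProd_mul_weightProd {q t : ℂ} (hq : ‖q‖ < 1) (x : Fin n → ℂ) :
    ratioProd x * weightProd q (fun _ => q) (fun _ => t) x = DeltaW q t x := by
  rw [ratioProd, weightProd, DeltaW, ← prod_mul_distrib]
  refine prod_congr rfl fun i _ => ?_
  rw [← prod_mul_distrib]
  refine prod_congr rfl fun k _ => ?_
  split_ifs
  · rw [qPochInf_eq_one_sub_mul hq (x i / x k)]
    ring
  · rw [one_mul]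

lemma norm_ofReal_lt_one {q : ℝ} (hq : 0 < q) (hq1 : q < 1) : ‖(q : ℂ)‖ < 1 := by
  rwa [Complex.norm_real, Real.norm_of_nonneg hq.le]

lemma ratioProd_mul_regDelta (hq : 0 < q) (hq1 : q < 1) (ht : 0 < t) (ht1 : t < 1)
    (x : Fin n → ℂ) (y : Fin m → ℂ) :
    ratioProd x * ratioProd y * regDelta q t x y = DeltaNM n m q t x y := by
  rw [DeltaNM_eq, ← ratioProd_mul_weightProd (norm_ofReal_lt_one hq hq1),
    ← ratioProd_mul_weightProd (norm_ofReal_lt_one ht ht1), regDelta]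
  ring

lemma differentiableAt_prod {ι E : Type*} [NormedAddCommGroup E] [NormedSpace ℂ E] {s : Finset ι}
    {f : ι → E → ℂ} {x : E} (hf : ∀ k, DifferentiableAt ℂ (f k) x) :
    DifferentiableAt ℂ (fun x => ∏ k ∈ s, f k x) x := by
  classical
  induction s using Finset.induction_on with
  | empty => simp
  | insert a s ha ih =>
    simp only [prod_insert ha]
    exact (hf a).fun_mul ih

lemma differentiableAt_weightProd {q : ℂ} (hq : ‖q‖ < 1) {a b x : Fin n → ℂ}
    (hx : ∀ i, x i ≠ 0) (hb : ∀ i j, i ≠ j → ‖b i * (x i / x j)‖ < 1) :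
    DifferentiableAt ℂ (weightProd q a b) x := by
  have hd : ∀ (c : ℂ) (i j : Fin n),
      DifferentiableAt ℂ (fun x : Fin n → ℂ => qPochInf (c * (x i / x j)) q) x := by
    intro c i j
    have h1 : DifferentiableAt ℂ (fun x : Fin n → ℂ => c * (x i / x j)) x := by
      simp only [div_eq_mul_inv]
      exact (differentiableAt_const c).fun_mul
        ((differentiableAt_apply i x).fun_mul ((differentiableAt_apply j x).fun_inv (hx j)))
    have h2 := differentiable_qPochInf hq (c * (x i / x j))
    exact h2.comp x h1
  unfold weightProd
  refine differentiableAt_prod fun i => ?_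
  refine differentiableAt_prod fun j => ?_
  split_ifs with h
  · simp only [div_eq_mul_inv (qPochInf _ _)]
    exact (hd _ i j).fun_mul ((hd _ i j).fun_inv (qPochInf_ne_zero hq (hb i j h)))
  · exact differentiableAt_const _

lemma diffAt₂_mixedWeight {p a b x : Fin n → ℂ} {y : Fin m → ℂ} (hx : ∀ i, x i ≠ 0)
    (hy : ∀ j, y j ≠ 0) (ha : ∀ i j, 1 - a i * (x i / y j) ≠ 0)
    (hb : ∀ i j, 1 - b i * (y j / x i) ≠ 0) :
    DiffAt₂ (fun x y => mixedWeight p a b x y) x y := by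
  unfold mixedWeight
  refine .prod fun i => .prod fun j => .div (.const _) ?_ (mul_ne_zero (ha i j) (hb i j))
  have h1 : DifferentiableAt ℂ (fun z : (Fin n → ℂ) × (Fin m → ℂ) => z.1 i) (x, y) :=
    differentiableAt_pi.1 differentiableAt_fst i
  have h2 : DifferentiableAt ℂ (fun z : (Fin n → ℂ) × (Fin m → ℂ) => z.2 j) (x, y) :=
    differentiableAt_pi.1 differentiableAt_snd j
  have h3 := h1.fun_inv (hx i)
  have h4 := h2.fun_inv (hy j)
  simp only [div_eq_mul_inv]
  unfold DiffAt₂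
  exact (((differentiableAt_const _).fun_sub
    ((differentiableAt_const _).fun_mul (h1.fun_mul h4))).fun_mul
    ((differentiableAt_const _).fun_sub ((differentiableAt_const _).fun_mul (h2.fun_mul h3))))

lemma diffAt₂_fst {F : (Fin n → ℂ) → ℂ} {x : Fin n → ℂ} (y : Fin m → ℂ)
    (h : DifferentiableAt ℂ F x) : DiffAt₂ (fun x _ => F x) x y :=
  DifferentiableAt.comp (g := F) (x, y) h differentiableAt_fst

lemma diffAt₂_snd {F : (Fin m → ℂ) → ℂ} (x : Fin n → ℂ) {y : Fin m → ℂ}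
    (h : DifferentiableAt ℂ F y) : DiffAt₂ (fun _ y => F y) x y :=
  DifferentiableAt.comp (g := F) (x, y) h differentiableAt_snd

lemma diffAt₂_weight (a : Fin n → ℂ) (a' : Fin m → ℂ) (hq : 0 < q) (hq1 : q < 1)
    (ht : 0 < t) (ht1 : t < 1)
    {x : Fin n → ℂ} {y : Fin m → ℂ} (hx : ∀ i, x i ≠ 0) (hy : ∀ j, y j ≠ 0)
    (hx' : ∀ i k, ‖x i‖ = ‖x k‖) (hy' : ∀ j l, ‖y j‖ = ‖y l‖)
    (ha : ∀ i j, ‖mixConst q t * (x i / y j)‖ ≠ 1) (hb : ∀ i j, ‖mixConst q t * (y j / x i)‖ ≠ 1) :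
    DiffAt₂ (fun x y => weightProd q a (fun _ => t) x * weightProd t a' (fun _ => q) y *
      mixedWeight 1 (fun _ => mixConst q t) (fun _ => mixConst q t) x y) x y := by
  have hs : ∀ z : ℂ, ‖z‖ ≠ 1 → 1 - z ≠ 0 := fun z hz h => hz (by
    rw [← sub_eq_zero.1 h, norm_one])
  refine .mul (.mul (diffAt₂_fst y (differentiableAt_weightProd (norm_ofReal_lt_one hq hq1) hx
    fun i k _ => ?_)) (diffAt₂_snd x (differentiableAt_weightProd (norm_ofReal_lt_one ht ht1) hy
    fun i k _ => ?_))) (diffAt₂_mixedWeight hx hy (fun i j => hs _ (ha i j))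
    fun i j => hs _ (hb i j))
  · rw [norm_mul, norm_div, hx' i k, div_self (norm_ne_zero_iff.2 (hx k)), mul_one]
    exact norm_ofReal_lt_one ht ht1
  · rw [norm_mul, norm_div, hy' i k, div_self (norm_ne_zero_iff.2 (hy k)), mul_one]
    exact norm_ofReal_lt_one hq hq1

/-- Inversion of both sets of variables leaves the symmetric weights unchanged. -/
lemma DeltaW_inv {q t : ℂ} (x : Fin n → ℂ) : DeltaW q t x⁻¹ = DeltaW q t x := by
  rw [DeltaW, prod_comm, DeltaW]
  refine prod_congr rfl fun i _ => prod_congr rfl fun j _ => ?_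
  simp only [Pi.inv_apply, inv_div_inv, ne_comm (a := j)]

lemma DeltaNM_inv (x : Fin n → ℂ) (y : Fin m → ℂ) :
    DeltaNM n m q t x⁻¹ y⁻¹ = DeltaNM n m q t x y := by
  rw [DeltaNM_eq, DeltaNM_eq, DeltaW_inv, DeltaW_inv]
  congr 1
  refine prod_congr rfl fun i _ => prod_congr rfl fun j _ => ?_
  simp only [Pi.inv_apply, inv_div_inv]
  rw [mul_comm (1 - _)]

lemma shiftWeight_scaleOn (hq : q ≠ 0) (i : Fin n) (x : Fin n → ℂ) (y : Fin m → ℂ) :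
    shiftWeight q t i (scaleOn {i} (q : ℂ)⁻¹ x) y = shiftWeight q t i x⁻¹ y⁻¹ := by
  have cq : (q : ℂ) ≠ 0 := by exact_mod_cast hq
  rw [shiftWeight, shiftWeight, DeltaW_inv]
  refine congrArg₂ _ (congrArg (· * _) ?_) ?_
  · rw [weightProd, weightProd, prod_comm]
    refine prod_congr rfl fun k _ => prod_congr rfl fun l _ => ?_
    refine if_ctx_congr ne_comm (fun hkl => ?_) fun _ => rfl
    have h1 : (if l = i then (q : ℂ) else 1) *
        (scaleOn {i} (q : ℂ)⁻¹ x l / scaleOn {i} (q : ℂ)⁻¹ x k) =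
        (if k = i then (q : ℂ) else 1) * (x⁻¹ k / x⁻¹ l) := by
      by_cases hl : l = i
      · subst hl
        simp only [scaleOn, mem_singleton, if_true, if_neg hkl, Pi.inv_apply, inv_div_inv]
        field_simp
      · by_cases hk : k = i
        · subst hk
          simp only [scaleOn, mem_singleton, if_true, if_neg hl, Pi.inv_apply, inv_div_inv]
          field_simp
        · simp only [scaleOn, mem_singleton, if_neg hl, if_neg hk, Pi.inv_apply, inv_div_inv]
    rw [mul_assoc, mul_assoc, h1]
  · refine prod_congr rfl fun k _ => prod_congr rfl fun j _ => ?_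
    by_cases hk : k = i
    · subst hk
      simp only [scaleOn, mem_singleton, if_true, Pi.inv_apply, inv_div_inv]
      rw [mul_comm (1 - _)]
      congr 3
      · field_simp
      · field_simp
    · simp only [scaleOn, mem_singleton, if_neg hk, Pi.inv_apply, inv_div_inv]
      rw [mul_comm (1 - _)]
      simp

lemma prod_prod_eq_mul_prod_row {ι κ : Type*} [Fintype ι] [Fintype κ] [DecidableEq ι] (i : ι)
    (f g : ι → κ → ℂ) (c : κ → ℂ) (h : ∀ k l, k ≠ i → f k l = g k l)
    (hc : ∀ l, f i l = g i l * c l) : ∏ k, ∏ l, f k l = (∏ k, ∏ l, g k l) * ∏ l, c l := by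
  rw [← mul_prod_erase univ _ (mem_univ i), ← mul_prod_erase univ (fun k => ∏ l, g k l)
    (mem_univ i), prod_congr rfl fun l _ => hc l, prod_mul_distrib,
    prod_congr rfl fun k hk => prod_congr rfl fun l _ => h k l (ne_of_mem_erase hk)]
  ring

lemma DeltaNM_mul_Acoef (hq : 0 < q) (hq1 : q < 1) (ht : 0 < t) (ht1 : t < 1) (i : Fin n)
    {x : Fin n → ℂ} {y : Fin m → ℂ} (h : GenericPt q t x y) (hx : ∀ i k, ‖x i‖ = ‖x k‖)
    (hc : ∀ i j, ‖mixConst q t * (x i / y j)‖ ≠ 1) :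
    DeltaNM n m q t x y * Acoef n m q t i x y = shiftWeight q t i x y := by
  have cq : (Real.sqrt q : ℂ) ≠ 0 := by exact_mod_cast (Real.sqrt_pos.2 hq).ne'
  have cq2 : (Real.sqrt q : ℂ) ^ 2 = q := by exact_mod_cast Real.sq_sqrt hq.le
  have h1 : DeltaW q t x * (∏ k, if k ≠ i then ((t : ℂ) * x i - x k) / (x i - x k) else 1) =
      weightProd q (fun k => if k = i then q else 1)
        (fun k => t * if k = i then (q : ℂ) else 1) x := by
    refine (prod_prod_eq_mul_prod_row i _ _ _ (fun k l hk => ?_) fun l => ?_).symm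
    · simp only [if_neg hk, one_mul, mul_one]
    · by_cases hl : l = i
      · simp [hl]
      · beta_reduce
        rw [if_pos (ne_comm.1 hl), if_pos hl, if_pos (ne_comm.1 hl), if_pos rfl]
        have n1 := norm_ofReal_lt_one hq hq1
        have n2 := norm_ofReal_lt_one ht ht1
        have hu : ‖x i / x l‖ = 1 := by
          rw [norm_div, hx i l, div_self (norm_ne_zero_iff.2 (h.x_ne_zero l))]
        have hxl := h.x_ne_zero l
        have e0 : x i - x l ≠ 0 := sub_ne_zero.2 (h.x_ne i l (Ne.symm hl))
        have e1 : ((t : ℂ) * x i - x l) / (x i - x l) =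
            (1 - t * (x i / x l)) / (1 - x i / x l) := by
          have e5 : (t : ℂ) * x i - x l = -x l * (1 - t * (x i / x l)) := by field_simp; ring
          have e6 : x i - x l = -x l * (1 - x i / x l) := by field_simp; ring
          rw [e5, e6, mul_div_mul_left _ _ (neg_ne_zero.2 hxl)]
        have e2 : 1 - x i / x l ≠ 0 := by
          intro h0
          refine h.x_ne i l (Ne.symm hl) ?_
          rw [sub_eq_zero, eq_comm, div_eq_one_iff_eq hxl] at h0
          exact h0
        have e3 : 1 - (t : ℂ) * (x i / x l) ≠ 0 := by
          intro h0
          have := congrArg norm (sub_eq_zero.1 h0)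
          rw [norm_one, norm_mul, hu, mul_one] at this
          exact n2.ne this.symm
        have e4 : qPochInf ((q : ℂ) * (t * (x i / x l))) q ≠ 0 := by
          refine qPochInf_ne_zero n1 ?_
          rw [norm_mul, norm_mul, hu, mul_one]
          exact mul_lt_one_of_nonneg_of_lt_one_left (norm_nonneg _) n1 n2.le
        rw [e1, qPochInf_eq_one_sub_mul n1 (x i / x l),
          qPochInf_eq_one_sub_mul n1 (t * (x i / x l)), mul_comm (t : ℂ) q, mul_assoc (q : ℂ) t]
        generalize x i / x l = u at e2 e3 e4 ⊢
        generalize qPochInf ((q : ℂ) * (t * u)) q = v at e4 ⊢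
        generalize (t : ℂ) * u = w at e3 ⊢
        field_simp
  have h2 : mixedWeight 1 (fun _ => mixConst q t) (fun _ => mixConst q t) x y *
      (∏ j, ((Real.sqrt t : ℂ) * x i - (Real.sqrt q : ℂ) * y j) /
        ((Real.sqrt t : ℂ) * x i - (Real.sqrt q : ℂ)⁻¹ * y j)) =
      mixedWeight (fun k => if k = i then q else 1)
        (fun k => mixConst q t * if k = i then (q : ℂ) else 1) (fun _ => mixConst q t) x y := by
    refine (prod_prod_eq_mul_prod_row i _ _ _ (fun k l hk => ?_) fun j => ?_).symm
    · simp only [if_neg hk, mul_one, Pi.one_apply]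
    · have hyj := h.y_ne_zero j
      simp only [if_true, Pi.one_apply]
      have e1 : 1 - mixConst q t * (x i / y j) ≠ 0 := fun h0 => hc i j (by
        rw [← sub_eq_zero.1 h0, norm_one])
      have e2 : (Real.sqrt t : ℂ) * x i - (Real.sqrt q : ℂ) * y j =
          -(Real.sqrt q * y j) * (1 - mixConst q t * (x i / y j)) := by
        rw [mixConst]; field_simp; ring
      have e3 : (Real.sqrt t : ℂ) * x i - (Real.sqrt q : ℂ)⁻¹ * y j =
          -((Real.sqrt q : ℂ)⁻¹ * y j) * (1 - mixConst q t * q * (x i / y j)) := by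
        rw [mixConst, ← cq2]; field_simp; ring
      rw [e2, e3, mul_div_mul_comm]
      have e4 : -(Real.sqrt q * y j) / -((Real.sqrt q : ℂ)⁻¹ * y j) = q := by
        rw [← cq2]; field_simp
      rw [e4]
      generalize 1 - mixConst q t * (x i / y j) = u at e1 ⊢
      field_simp
  rw [DeltaNM_eq, Acoef, shiftWeight, ← h1, ← h2]
  ring

end Weight

section Shift

variable {n m : ℕ} {q t ξ ξ' : ℝ}

/-- Complex differentiability away from the coordinate hyperplanes. -/
def DiffNeZero (F : (Fin n → ℂ) → (Fin m → ℂ) → ℂ) : Prop :=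
  ∀ x y, (∀ i, x i ≠ 0) → (∀ j, y j ≠ 0) → DiffAt₂ F x y

/-- Both functions are integrable over the torus, with the same integral. -/
def SameInt (ξ ξ' : ℝ) (F G : (Fin n → ℂ) → (Fin m → ℂ) → ℂ) : Prop :=
  Integrable (fun w : Torus n m => F (torusPt ξ w.1) (torusPt ξ' w.2)) ∧
  Integrable (fun w : Torus n m => G (torusPt ξ w.1) (torusPt ξ' w.2)) ∧
  torusInt ξ ξ' F = torusInt ξ ξ' G

lemma update_mul_eq_scaleOn (i : Fin n) (c : ℂ) (x : Fin n → ℂ) :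
    Function.update x i (c * x i) = scaleOn {i} c x := by
  funext k
  by_cases hk : k = i
  · subst hk; simp [scaleOn]
  · simp [scaleOn, hk]

/-- The ratio of the radii is so far from `1` that no pole of the weight function is met when one
variable is shifted. -/
def Separated (q t ξ ξ' : ℝ) : Prop :=
  ξ' < Real.sqrt q * Real.sqrt t * ξ ∨ ξ < Real.sqrt q * Real.sqrt t * ξ'

lemma scaleOn_scaleOn (S : Finset (Fin n)) (a b : ℂ) (x : Fin n → ℂ) :
    scaleOn S a (scaleOn S b x) = scaleOn S (a * b) x := by
  funext k
  simp only [scaleOn]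
  split_ifs
  · rw [mul_assoc]
  · rfl

lemma scaleOn_one (S : Finset (Fin n)) (x : Fin n → ℂ) : scaleOn S 1 x = x := by
  funext k
  simp [scaleOn]

lemma scaleOn_ne_zero {S : Finset (Fin n)} {a : ℂ} {x : Fin n → ℂ} (ha : a ≠ 0)
    (hx : ∀ i, x i ≠ 0) (i : Fin n) : scaleOn S a x i ≠ 0 := by
  simp only [scaleOn]
  split_ifs
  exacts [mul_ne_zero ha (hx i), hx i]

lemma DiffAt₂.comp_scaleOn {F : (Fin n → ℂ) → (Fin m → ℂ) → ℂ} {a : ℂ} {S : Finset (Fin n)}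
    {x : Fin n → ℂ} {y : Fin m → ℂ} (hF : DiffAt₂ F (scaleOn S a x) y) :
    DiffAt₂ (fun x y => F (scaleOn S a x) y) x y := by
  have h1 : DifferentiableAt ℂ (fun z : (Fin n → ℂ) × (Fin m → ℂ) => (scaleOn S a z.1, z.2))
      (x, y) := by
    refine DifferentiableAt.prodMk (differentiableAt_pi.2 fun k => ?_) differentiableAt_snd
    have hk : DifferentiableAt ℂ (fun z : (Fin n → ℂ) × (Fin m → ℂ) => z.1 k) (x, y) :=
      differentiableAt_pi.1 differentiableAt_fst k
    simp only [scaleOn]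
    split_ifs
    exacts [(differentiableAt_const a).fun_mul hk, hk]
  have h2 : DifferentiableAt ℂ (fun z : (Fin n → ℂ) × (Fin m → ℂ) => F z.1 z.2)
    (scaleOn S a x, y) := hF
  exact DifferentiableAt.comp (x, y) h2 h1

lemma GenericPt.inv {x : Fin n → ℂ} {y : Fin m → ℂ} (h : GenericPt q t x y) :
    GenericPt q t x⁻¹ y⁻¹ where
  x_ne_zero i := inv_ne_zero (h.x_ne_zero i)
  y_ne_zero j := inv_ne_zero (h.y_ne_zero j)
  x_ne i k hik e := h.x_ne i k hik (inv_injective e)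
  y_ne j l hjl e := h.y_ne j l hjl (inv_injective e)
  mul_x_ne i j e := h.x_ne_mul i j (by
    have h1 := h.x_ne_zero i
    have h2 := h.y_ne_zero j
    simp only [Pi.inv_apply] at e
    field_simp at e
    linear_combination -e)
  x_ne_mul i j e := h.mul_x_ne i j (by
    have h1 := h.x_ne_zero i
    have h2 := h.y_ne_zero j
    simp only [Pi.inv_apply] at e
    field_simp at e
    linear_combination -e)

lemma norm_mixConst (q t : ℝ) : ‖mixConst q t‖ = Real.sqrt t / Real.sqrt q := by
  rw [mixConst, norm_mul, norm_inv, Complex.norm_real, Complex.norm_real,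
    Real.norm_of_nonneg (Real.sqrt_nonneg q), Real.norm_of_nonneg (Real.sqrt_nonneg t),
    inv_mul_eq_div]

lemma conj_Acoef (i : Fin n) (x : Fin n → ℂ) (y : Fin m → ℂ) :
    starRingEnd ℂ (Acoef n m q t i (fun k => (starRingEnd ℂ (x k))⁻¹)
      fun j => (starRingEnd ℂ (y j))⁻¹) = Acoef n m q t i x⁻¹ y⁻¹ := by
  simp only [Acoef, map_mul, map_prod, apply_ite (starRingEnd ℂ), map_div₀, map_sub, map_inv₀,
    Complex.conj_conj, Complex.conj_ofReal, map_one, Pi.inv_apply]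

/-- One summand of the `x`-part of the deformed operator. -/
def xShift (q t : ℝ) (i : Fin n) (F : (Fin n → ℂ) → (Fin m → ℂ) → ℂ) :
    (Fin n → ℂ) → (Fin m → ℂ) → ℂ :=
  fun x y => Acoef n m q t i x y * F (Function.update x i ((q : ℂ) * x i)) y

/-- One summand of the `y`-part of the deformed operator. -/
def yShift (q t : ℝ) (j : Fin m) (F : (Fin n → ℂ) → (Fin m → ℂ) → ℂ) :
    (Fin n → ℂ) → (Fin m → ℂ) → ℂ :=
  fun x y => Bcoef n m q t j x y * F x (Function.update y j ((t : ℂ)⁻¹ * y j))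

lemma diffAt₂_shiftWeight (hq : 0 < q) (hq1 : q < 1) (ht : 0 < t) (ht1 : t < 1) (i : Fin n)
    {x : Fin n → ℂ} {y : Fin m → ℂ} (hx : ∀ i, x i ≠ 0) (hy : ∀ j, y j ≠ 0)
    (hx' : ∀ k l, k ≠ l → ‖((t : ℂ) * if k = i then (q : ℂ) else 1) * (x k / x l)‖ < 1)
    (hy' : ∀ j l, ‖y j‖ = ‖y l‖)
    (ha : ∀ k j, ‖(mixConst q t * if k = i then (q : ℂ) else 1) * (x k / y j)‖ ≠ 1)
    (hb : ∀ k j, ‖mixConst q t * (y j / x k)‖ ≠ 1) :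
    DiffAt₂ (shiftWeight q t i) x y := by
  have hs : ∀ z : ℂ, ‖z‖ ≠ 1 → 1 - z ≠ 0 := fun z hz h => hz (by
    rw [← sub_eq_zero.1 h, norm_one])
  have hW : DifferentiableAt ℂ (DeltaW (t : ℂ) (q : ℂ)) y := by
    have : DeltaW (t : ℂ) (q : ℂ) = weightProd t (fun _ : Fin m => 1) (fun _ => q) :=
      funext fun y => DeltaW_eq_weightProd y
    rw [this]
    refine differentiableAt_weightProd (norm_ofReal_lt_one ht ht1) hy fun j l _ => ?_
    rw [norm_mul, norm_div, hy' j l, div_self (norm_ne_zero_iff.2 (hy l)), mul_one]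
    exact norm_ofReal_lt_one hq hq1
  exact .mul (.mul (diffAt₂_fst y (differentiableAt_weightProd (norm_ofReal_lt_one hq hq1) hx hx'))
    (diffAt₂_snd x hW)) (diffAt₂_mixedWeight hx hy (fun k j => hs _ (ha k j))
    fun k j => hs _ (hb k j))

lemma diffAt₂_shiftWeight_scaleOn (hq : 0 < q) (hq1 : q < 1) (ht : 0 < t) (ht1 : t < 1)
    (hξ : 0 < ξ) (hξ' : 0 < ξ') (h : Separated q t ξ ξ') (i : Fin n) (w : Torus n m) {s : ℂ}
    (hs : 1 ≤ ‖s‖) (hs' : ‖s‖ ≤ q⁻¹) :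
    DiffAt₂ (shiftWeight q t i) (scaleOn {i} s (torusPt ξ w.1)) (torusPt ξ' w.2) := by
  have s0 : s ≠ 0 := norm_pos_iff.1 (by linarith)
  have hnx := fun k => norm_torusPt hξ w.1 k
  have hny := fun j => norm_torusPt hξ' w.2 j
  have hqs : q * ‖s‖ ≤ 1 := by
    calc q * ‖s‖ ≤ q * q⁻¹ := by gcongr
      _ = 1 := mul_inv_cancel₀ hq.ne'
  have nq : ‖(q : ℂ)‖ = q := by rw [Complex.norm_real, Real.norm_of_nonneg hq.le]
  have nt : ‖(t : ℂ)‖ = t := by rw [Complex.norm_real, Real.norm_of_nonneg ht.le]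
  obtain ⟨a, ha, ha1, rfl⟩ : ∃ a : ℝ, 0 < a ∧ a < 1 ∧ q = a ^ 2 :=
    ⟨√q, Real.sqrt_pos.2 hq, by rwa [Real.sqrt_lt' one_pos, one_pow], (Real.sq_sqrt hq.le).symm⟩
  obtain ⟨b, hb, hb1, rfl⟩ : ∃ b : ℝ, 0 < b ∧ b < 1 ∧ t = b ^ 2 :=
    ⟨√t, Real.sqrt_pos.2 ht, by rwa [Real.sqrt_lt' one_pos, one_pow], (Real.sq_sqrt ht.le).symm⟩
  have hc := norm_mixConst (a ^ 2) (b ^ 2)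
  rw [Separated] at h
  rw [Real.sqrt_sq ha.le, Real.sqrt_sq hb.le] at hc h
  refine diffAt₂_shiftWeight hq hq1 ht ht1 i (scaleOn_ne_zero s0 (torusPt_ne_zero hξ _))
    (torusPt_ne_zero hξ' _) (fun k l hkl => ?_) (fun j l => (hny j).trans (hny l).symm)
    (fun k j => ?_) (fun k j => ?_)
  · by_cases hk : k = i
    · have hl : l ≠ i := fun hl => hkl (hk.trans hl.symm)
      simp only [scaleOn, mem_singleton, if_pos hk, if_neg hl, norm_mul, norm_div, hnx, nq, nt]
      rw [mul_div_assoc, div_self hξ.ne']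
      nlinarith
    · by_cases hl : l = i
      · simp only [scaleOn, mem_singleton, if_pos hl, if_neg hk, norm_mul, norm_div, hnx, nt,
          mul_one]
        rw [div_mul_cancel_right₀ hξ.ne']
        have := inv_le_one_of_one_le₀ hs
        nlinarith
      · simp only [scaleOn, mem_singleton, if_neg hl, if_neg hk, norm_mul, norm_div, hnx, nt,
          mul_one]
        rwa [div_self hξ.ne', mul_one]
  · by_cases hk : k = i
    · simp only [scaleOn, mem_singleton, if_pos hk, norm_mul, norm_div, hnx, hny, nq, hc]
      have e : b / a * a ^ 2 * (‖s‖ * ξ / ξ') = (a * b * ξ * ‖s‖) / ξ' := by field_simp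
      rw [e]
      rcases h with h | h
      · refine ne_of_gt ?_
        rw [one_lt_div hξ']
        nlinarith
      · refine ne_of_lt ?_
        rw [div_lt_one hξ']
        calc a * b * ξ * ‖s‖ < a * b * (a * b * ξ') * ‖s‖ := by gcongr
          _ = b ^ 2 * ξ' * (a ^ 2 * ‖s‖) := by ring
          _ ≤ b ^ 2 * ξ' * 1 := by gcongr
          _ < ξ' := by nlinarith
    · simp only [scaleOn, mem_singleton, if_neg hk, norm_mul, norm_div, hnx, hny, hc, mul_one]
      rw [div_mul_div_comm]
      rcases h with h | h
      · refine ne_of_gt ?_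
        rw [one_lt_div (by positivity)]
        nlinarith [mul_pos hb hξ]
      · refine ne_of_lt ?_
        rw [div_lt_one (by positivity)]
        nlinarith [mul_pos ha hξ']
  · by_cases hk : k = i
    · simp only [scaleOn, mem_singleton, if_pos hk, norm_mul, norm_div, hnx, hny, hc]
      rw [div_mul_div_comm]
      rcases h with h | h
      · refine ne_of_lt ?_
        rw [div_lt_one (by positivity)]
        have : a * ξ ≤ a * (‖s‖ * ξ) := by gcongr; nlinarith
        nlinarith [mul_pos ha hξ]
      · refine ne_of_gt ?_
        rw [one_lt_div (by positivity)]
        calc a * (‖s‖ * ξ) < a * (‖s‖ * (a * b * ξ')) := by gcongr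
          _ = b * ξ' * (a ^ 2 * ‖s‖) := by ring
          _ ≤ b * ξ' * 1 := by gcongr
          _ = b * ξ' := mul_one _
    · simp only [scaleOn, mem_singleton, if_neg hk, norm_mul, norm_div, hnx, hny, hc]
      rw [div_mul_div_comm]
      rcases h with h | h
      · refine ne_of_lt ?_
        rw [div_lt_one (by positivity)]
        nlinarith [mul_pos ha hξ]
      · refine ne_of_gt ?_
        rw [one_lt_div (by positivity)]
        nlinarith [mul_pos hb hξ']

lemma ne_one_of_separated (hq : 0 < q) (hq1 : q < 1) (ht : 0 < t) (ht1 : t < 1)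
    (hξ : 0 < ξ) (hξ' : 0 < ξ') (h : Separated q t ξ ξ') {z w : ℂ} (hz : ‖z‖ = ξ) (hw : ‖w‖ = ξ') :
    ‖mixConst q t * (z / w)‖ ≠ 1 ∧ ‖mixConst q t * (w / z)‖ ≠ 1 := by
  obtain ⟨a, ha, ha1, rfl⟩ : ∃ a : ℝ, 0 < a ∧ a < 1 ∧ q = a ^ 2 :=
    ⟨√q, Real.sqrt_pos.2 hq, by rwa [Real.sqrt_lt' one_pos, one_pow], (Real.sq_sqrt hq.le).symm⟩
  obtain ⟨b, hb, hb1, rfl⟩ : ∃ b : ℝ, 0 < b ∧ b < 1 ∧ t = b ^ 2 :=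
    ⟨√t, Real.sqrt_pos.2 ht, by rwa [Real.sqrt_lt' one_pos, one_pow], (Real.sq_sqrt ht.le).symm⟩
  rw [Separated, Real.sqrt_sq ha.le, Real.sqrt_sq hb.le] at h
  rw [norm_mul, norm_mul, norm_div, norm_div, hz, hw, norm_mixConst, Real.sqrt_sq ha.le,
    Real.sqrt_sq hb.le, div_mul_div_comm, div_mul_div_comm]
  rcases h with h | h
  · constructor
    · refine ne_of_gt ?_
      rw [one_lt_div (by positivity)]
      nlinarith [mul_pos hb hξ]
    · refine ne_of_lt ?_
      rw [div_lt_one (by positivity)]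
      nlinarith [mul_pos ha hξ]
  · constructor
    · refine ne_of_lt ?_
      rw [div_lt_one (by positivity)]
      nlinarith [mul_pos ha hξ']
    · refine ne_of_gt ?_
      rw [one_lt_div (by positivity)]
      nlinarith [mul_pos hξ' hb]

/-- The summands of the `x`-part of the deformed operator are symmetric for the torus integral. -/
lemma sameInt_xShift (hq : 0 < q) (hq1 : q < 1) (ht : 0 < t) (ht1 : t < 1)
    (hξ : 0 < ξ) (hξ' : 0 < ξ') (h : Separated q t ξ ξ') (i : Fin n)
    {P Q : (Fin n → ℂ) → (Fin m → ℂ) → ℂ} (hP : DiffNeZero P) (hQ : DiffNeZero Q) :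
    SameInt ξ ξ' (fun x y => DeltaNM n m q t x y * xShift q t i P x y * starFun Q x y)
      (fun x y => DeltaNM n m q t x y * P x y * starFun (xShift q t i Q) x y) := by
  have q0 : (q : ℂ) ≠ 0 := by exact_mod_cast hq.ne'
  let F : (Fin n → ℂ) → (Fin m → ℂ) → ℂ := fun x y =>
    shiftWeight q t i x y * P (scaleOn {i} q x) y * starFun Q x y
  have hF : ∀ w : Torus n m, ∀ s : ℂ, 1 ≤ ‖s‖ → ‖s‖ ≤ q⁻¹ →
      DiffAt₂ F (scaleOn {i} s (torusPt ξ w.1)) (torusPt ξ' w.2) := by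
    intro w s hs hs'
    have hx : ∀ k, scaleOn {i} s (torusPt ξ w.1) k ≠ 0 :=
      scaleOn_ne_zero (norm_pos_iff.1 (by linarith)) (torusPt_ne_zero hξ _)
    exact .mul (.mul (diffAt₂_shiftWeight_scaleOn hq hq1 ht ht1 hξ hξ' h i w hs hs')
      (hP _ _ (scaleOn_ne_zero q0 hx) (torusPt_ne_zero hξ' _)).comp_scaleOn)
      (diffAt₂_starFun hQ hx (torusPt_ne_zero hξ' _))
  have hq2 : 1 ≤ q⁻¹ := (one_le_inv₀ hq).2 hq1.le
  have hn := fun (w : Torus n m) i j => ne_one_of_separated hq hq1 ht ht1 hξ hξ' h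
    (norm_torusPt hξ w.1 i) (norm_torusPt hξ' w.2 j)
  have hx := fun (w : Torus n m) k l =>
    (norm_torusPt hξ w.1 k).trans (norm_torusPt hξ w.1 l).symm
  have h1 : ∀ᵐ w : Torus n m, (fun x y => F (scaleOn {i} ((1 : ℝ) : ℂ) x) y)
        (torusPt ξ w.1) (torusPt ξ' w.2) =
      (fun x y => DeltaNM n m q t x y * xShift q t i P x y * starFun Q x y)
        (torusPt ξ w.1) (torusPt ξ' w.2) := by
    filter_upwards [ae_genericPt hq ht hξ hξ'] with w hw
    simp only [F, ofReal_one, scaleOn_one, xShift, update_mul_eq_scaleOn,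
      ← DeltaNM_mul_Acoef hq hq1 ht ht1 i hw (hx w) fun i j => (hn w i j).1]
    ring
  have h2 : ∀ᵐ w : Torus n m, (fun x y => F (scaleOn {i} ((q⁻¹ : ℝ) : ℂ) x) y)
        (torusPt ξ w.1) (torusPt ξ' w.2) =
      (fun x y => DeltaNM n m q t x y * P x y * starFun (xShift q t i Q) x y)
        (torusPt ξ w.1) (torusPt ξ' w.2) := by
    filter_upwards [ae_genericPt hq ht hξ hξ'] with w hw
    generalize hX : torusPt ξ w.1 = x at *
    generalize hY : torusPt ξ' w.2 = y at *
    have e1 : starFun (xShift q t i Q) x y =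
        Acoef n m q t i x⁻¹ y⁻¹ * starFun Q (scaleOn {i} (q : ℂ)⁻¹ x) y := by
      simp only [starFun, xShift, map_mul, conj_Acoef, update_mul_eq_scaleOn]
      congr 3
      funext k
      simp only [scaleOn]
      split_ifs
      · simp [mul_comm]
      · rfl
    have e2 := DeltaNM_mul_Acoef hq hq1 ht ht1 i hw.inv (fun k l => by
      have := hx w k l
      rw [hX] at this
      simp [this]) (fun k j => by
      have := (hn w k j).2
      rw [hX, hY] at this
      simpa only [Pi.inv_apply, inv_div_inv] using this)
    rw [DeltaNM_inv] at e2
    simp only [F, ofReal_inv, scaleOn_scaleOn, mul_inv_cancel₀ q0, scaleOn_one,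
      shiftWeight_scaleOn hq.ne', e1, ← e2]
    ring
  have hI : ∀ c : ℝ, 1 ≤ c → c ≤ q⁻¹ → Integrable fun w : Torus n m =>
      F (scaleOn {i} (c : ℂ) (torusPt ξ w.1)) (torusPt ξ' w.2) := fun c hc hc' =>
    have hn : ‖(c : ℂ)‖ = c := by rw [Complex.norm_real, Real.norm_of_nonneg (by linarith)]
    integrable_comp_torusPt fun w => (hF w c (hc.trans_eq hn.symm)
      (hn.trans_le hc')).comp_scaleOn
  refine ⟨(hI 1 le_rfl hq2).congr h1, (hI _ hq2 le_rfl).congr h2, ?_⟩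
  rw [torusInt, torusInt, ← integral_congr_ae h1, ← integral_congr_ae h2]
  exact (torusInt_scaleOn_eq F {i} one_pos hq2 hF).symm

end Shift

section Duality

variable {n m : ℕ} {q t ξ ξ' : ℝ}

instance isNegInvariant_volume_torus (n m : ℕ) :
    (volume : Measure (Torus n m)).IsNegInvariant :=
  have : (volume : Measure (Torus n m)).Regular :=
    Measure.Regular.of_sigmaCompactSpace_of_isLocallyFiniteMeasure (volume : Measure (Torus n m))
  Measure.IsAddHaarMeasure.isNegInvariant_of_regular _

lemma SameInt.of_const_mul {F G : (Fin n → ℂ) → (Fin m → ℂ) → ℂ} {c : ℂ} (hc : c ≠ 0)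
    (h : SameInt ξ ξ' (fun x y => c * F x y) fun x y => c * G x y) : SameInt ξ ξ' F G := by
  obtain ⟨h1, h2, h3⟩ := h
  refine ⟨(integrable_const_mul_iff (IsUnit.mk0 c hc) _).1 h1,
    (integrable_const_mul_iff (IsUnit.mk0 c hc) _).1 h2, ?_⟩
  simp only [torusInt, integral_const_mul] at h3
  exact mul_left_cancel₀ hc h3

lemma SameInt.congr {F G F' G' : (Fin n → ℂ) → (Fin m → ℂ) → ℂ} (hξ : 0 < ξ) (hξ' : 0 < ξ')
    (h : SameInt ξ ξ' F G) (hF : ∀ x y, (∀ i, x i ≠ 0) → (∀ j, y j ≠ 0) → F x y = F' x y)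
    (hG : ∀ x y, (∀ i, x i ≠ 0) → (∀ j, y j ≠ 0) → G x y = G' x y) : SameInt ξ ξ' F' G' := by
  have h1 : (fun w : Torus n m => F (torusPt ξ w.1) (torusPt ξ' w.2)) =
      fun w => F' (torusPt ξ w.1) (torusPt ξ' w.2) :=
    funext fun w => hF _ _ (torusPt_ne_zero hξ _) (torusPt_ne_zero hξ' _)
  have h2 : (fun w : Torus n m => G (torusPt ξ w.1) (torusPt ξ' w.2)) =
      fun w => G' (torusPt ξ w.1) (torusPt ξ' w.2) :=
    funext fun w => hG _ _ (torusPt_ne_zero hξ _) (torusPt_ne_zero hξ' _)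
  simpa only [SameInt, torusInt, h1, h2] using h

/-- Inversion of all variables combined with the exchange of the two sets of variables. -/
def dualFun (F : (Fin n → ℂ) → (Fin m → ℂ) → ℂ) : (Fin m → ℂ) → (Fin n → ℂ) → ℂ :=
  fun x y => F y⁻¹ x⁻¹

lemma torusPt_inv_neg (u : Fin n → AddCircle (2 * Real.pi)) :
    torusPt ξ⁻¹ (-u) = (torusPt ξ u)⁻¹ := by
  funext i
  simp only [torusPt, Pi.neg_apply, circleExp_neg, Pi.inv_apply, ofReal_inv, mul_inv]

lemma SameInt.of_dual {F G : (Fin n → ℂ) → (Fin m → ℂ) → ℂ}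
    (h : SameInt ξ'⁻¹ ξ⁻¹ (dualFun F) (dualFun G)) : SameInt ξ ξ' F G := by
  have key : ∀ H : (Fin n → ℂ) → (Fin m → ℂ) → ℂ,
      (fun w : Torus n m => H (torusPt ξ w.1) (torusPt ξ' w.2)) =
      fun w => (fun v : Torus m n => dualFun H (torusPt ξ'⁻¹ v.1) (torusPt ξ⁻¹ v.2))
        (-w.swap) := by
    intro H
    funext w
    simp only [dualFun, Prod.fst_neg, Prod.snd_neg, Prod.fst_swap, Prod.snd_swap,
      torusPt_inv_neg, inv_inv]
  have hint : ∀ H : (Fin n → ℂ) → (Fin m → ℂ) → ℂ,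
      torusInt ξ ξ' H = torusInt ξ'⁻¹ ξ⁻¹ (dualFun H) := by
    intro H
    rw [torusInt, torusInt, key]
    rw [← integral_neg_eq_self (fun v : Torus m n =>
      dualFun H (torusPt ξ'⁻¹ v.1) (torusPt ξ⁻¹ v.2)) volume]
    exact integral_prod_swap (fun v : Torus m n =>
      dualFun H (torusPt ξ'⁻¹ (-v).1) (torusPt ξ⁻¹ (-v).2))
  obtain ⟨h1, h2, h3⟩ := h
  refine ⟨?_, ?_, by rw [hint, hint, h3]⟩
  · rw [key]
    exact h1.comp_neg.swap
  · rw [key]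
    exact h2.comp_neg.swap

lemma starFun_dualFun (F : (Fin n → ℂ) → (Fin m → ℂ) → ℂ) :
    starFun (dualFun F) = dualFun (starFun F) := by
  funext x y
  simp only [starFun, dualFun]
  congr 2 <;> funext k <;> simp

lemma DiffNeZero.dualFun {F : (Fin n → ℂ) → (Fin m → ℂ) → ℂ} (hF : DiffNeZero F) :
    DiffNeZero (dualFun F) := by
  intro x y hx hy
  have h2 : DifferentiableAt ℂ (fun z : (Fin m → ℂ) × (Fin n → ℂ) => (z.2⁻¹, z.1⁻¹)) (x, y) := by
    refine DifferentiableAt.prodMk ?_ ?_ <;> rw [differentiableAt_pi] <;> intro k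
    · exact (differentiableAt_pi.1 differentiableAt_snd k).fun_inv (hy k)
    · exact (differentiableAt_pi.1 differentiableAt_fst k).fun_inv (hx k)
  have h1 : DifferentiableAt ℂ (fun z : (Fin n → ℂ) × (Fin m → ℂ) => F z.1 z.2) (y⁻¹, x⁻¹) :=
    hF _ _ (fun i => inv_ne_zero (hy i)) fun j => inv_ne_zero (hx j)
  exact DifferentiableAt.comp (x, y) h1 h2

lemma DeltaNM_dual (hq : 0 < q) (ht : 0 < t) {x : Fin n → ℂ} {y : Fin m → ℂ}
    (hx : ∀ i, x i ≠ 0) (hy : ∀ j, y j ≠ 0) :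
    DeltaNM m n t q y⁻¹ x⁻¹ = (∏ _i : Fin n, ∏ _j : Fin m, mixConst q t ^ 2) *
      DeltaNM n m q t x y := by
  have hm : mixConst q t ≠ 0 := mul_ne_zero
    (inv_ne_zero (by exact_mod_cast (Real.sqrt_pos.2 hq).ne'))
    (by exact_mod_cast (Real.sqrt_pos.2 ht).ne')
  have hm' : mixConst t q = (mixConst q t)⁻¹ := by
    rw [mixConst, mixConst, mul_inv, inv_inv, mul_comm]
  have h : mixedWeight 1 (fun _ => mixConst t q) (fun _ => mixConst t q) y⁻¹ x⁻¹ =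
      (∏ _i : Fin n, ∏ _j : Fin m, mixConst q t ^ 2) *
        mixedWeight 1 (fun _ => mixConst q t) (fun _ => mixConst q t) x y := by
    rw [mixedWeight, mixedWeight, prod_comm, ← prod_mul_distrib]
    refine prod_congr rfl fun i _ => ?_
    rw [← prod_mul_distrib]
    refine prod_congr rfl fun j _ => ?_
    simp only [Pi.inv_apply, inv_div_inv, Pi.one_apply, hm', one_div]
    have h1 := hx i
    have h2 := hy j
    generalize mixConst q t = c at hm ⊢
    have e1 : 1 - c⁻¹ * (x i / y j) = -(c⁻¹ * (x i / y j)) * (1 - c * (y j / x i)) := by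
      field_simp; ring
    have e2 : 1 - c⁻¹ * (y j / x i) = -(c⁻¹ * (y j / x i)) * (1 - c * (x i / y j)) := by
      field_simp; ring
    rw [e1, e2, mul_inv, mul_inv, mul_inv, mul_inv]
    field_simp
  rw [DeltaNM_eq, DeltaNM_eq, DeltaW_inv, DeltaW_inv, h]
  ring

lemma Acoef_dual (hq : 0 < q) (ht : 0 < t) (j : Fin m) {x : Fin n → ℂ} {y : Fin m → ℂ}
    (hx : ∀ i, x i ≠ 0) (hy : ∀ j, y j ≠ 0) :
    Acoef m n t q j y⁻¹ x⁻¹ =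
      (((∏ l : Fin m, if l ≠ j then q else 1) * ∏ _i : Fin n, t : ℝ) : ℂ) *
        Bcoef n m q t j x y := by
  have h1 : (Real.sqrt q : ℂ) ≠ 0 := by exact_mod_cast (Real.sqrt_pos.2 hq).ne'
  have h2 : (Real.sqrt t : ℂ) ≠ 0 := by exact_mod_cast (Real.sqrt_pos.2 ht).ne'
  have h3 : (Real.sqrt t : ℂ) ^ 2 = t := by exact_mod_cast Real.sq_sqrt ht.le
  have h4 : (q : ℂ) ≠ 0 := by exact_mod_cast hq.ne'
  rw [Acoef, Bcoef, ofReal_mul, mul_mul_mul_comm, ofReal_prod, ofReal_prod, ← prod_mul_distrib,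
    ← prod_mul_distrib]
  congr 1
  · refine prod_congr rfl fun l _ => ?_
    split_ifs
    · have hj := hy j
      have hl := hy l
      have e1 : (q : ℂ) * y⁻¹ j - y⁻¹ l = -((y j * y l)⁻¹ * q) * ((q : ℂ)⁻¹ * y j - y l) := by
        simp only [Pi.inv_apply]; field_simp; ring
      have e2 : y⁻¹ j - y⁻¹ l = -(y j * y l)⁻¹ * (y j - y l) := by
        simp only [Pi.inv_apply]; field_simp; ring
      rw [e1, e2, mul_div_mul_comm]
      congr 1
      field_simp
    · simp
  · refine prod_congr rfl fun i _ => ?_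
    have hj := hy j
    have hi := hx i
    have e1 : (Real.sqrt q : ℂ) * y⁻¹ j - Real.sqrt t * x⁻¹ i =
        -(Real.sqrt q * Real.sqrt t * (y j * x i)⁻¹) *
          ((Real.sqrt q : ℂ)⁻¹ * y j - (Real.sqrt t : ℂ)⁻¹ * x i) := by
      simp only [Pi.inv_apply]; field_simp; ring
    have e2 : (Real.sqrt q : ℂ) * y⁻¹ j - (Real.sqrt t : ℂ)⁻¹ * x⁻¹ i =
        -(Real.sqrt q * (Real.sqrt t : ℂ)⁻¹ * (y j * x i)⁻¹) *
          ((Real.sqrt q : ℂ)⁻¹ * y j - Real.sqrt t * x i) := by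
      simp only [Pi.inv_apply]; field_simp; ring
    rw [e1, e2, mul_div_mul_comm, ← h3]
    congr 1
    field_simp

lemma xShift_dualFun (hq : 0 < q) (ht : 0 < t) (j : Fin m)
    (F : (Fin n → ℂ) → (Fin m → ℂ) → ℂ) {x : Fin m → ℂ} {y : Fin n → ℂ}
    (hx : ∀ i, x i ≠ 0) (hy : ∀ j, y j ≠ 0) :
    xShift t q j (dualFun F) x y =
      (((∏ l : Fin m, if l ≠ j then q else 1) * ∏ _i : Fin n, t : ℝ) : ℂ) *
        dualFun (yShift q t j F) x y := by
  have h := Acoef_dual hq ht j (x := y⁻¹) (y := x⁻¹) (fun i => inv_ne_zero (hy i))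
    fun i => inv_ne_zero (hx i)
  rw [inv_inv, inv_inv] at h
  have e : (Function.update x j ((t : ℂ) * x j))⁻¹ =
      Function.update x⁻¹ j ((t : ℂ)⁻¹ * x⁻¹ j) := by
    funext k
    by_cases hk : k = j
    · subst hk; simp [mul_comm]
    · simp [hk]
  simp only [xShift, yShift, dualFun, h, e]
  ring

lemma Separated.dual (hξ : 0 < ξ) (hξ' : 0 < ξ') (h : Separated q t ξ ξ') :
    Separated t q ξ'⁻¹ ξ⁻¹ := by
  rw [Separated, mul_comm (√t)]
  refine h.imp (fun h => ?_) fun h => ?_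
  · rw [← div_eq_mul_inv, lt_div_iff₀ hξ', inv_mul_eq_div, div_lt_iff₀ hξ]
    exact h
  · rw [← div_eq_mul_inv, lt_div_iff₀ hξ, inv_mul_eq_div, div_lt_iff₀ hξ']
    exact h

/-- The summands of the `y`-part of the deformed operator are symmetric for the torus integral. -/
lemma sameInt_yShift (hq : 0 < q) (hq1 : q < 1) (ht : 0 < t) (ht1 : t < 1)
    (hξ : 0 < ξ) (hξ' : 0 < ξ') (h : Separated q t ξ ξ') (j : Fin m)
    {P Q : (Fin n → ℂ) → (Fin m → ℂ) → ℂ} (hP : DiffNeZero P) (hQ : DiffNeZero Q) :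
    SameInt ξ ξ' (fun x y => DeltaNM n m q t x y * yShift q t j P x y * starFun Q x y)
      (fun x y => DeltaNM n m q t x y * P x y * starFun (yShift q t j Q) x y) := by
  have hκ0 : (∏ l : Fin m, if l ≠ j then q else 1) * ∏ _i : Fin n, t ≠ 0 :=
    mul_ne_zero (prod_ne_zero_iff.2 fun l _ => by split_ifs; exacts [hq.ne', one_ne_zero])
      (prod_ne_zero_iff.2 fun _ _ => ht.ne')
  have hm : mixConst q t ≠ 0 := mul_ne_zero
    (inv_ne_zero (by exact_mod_cast (Real.sqrt_pos.2 hq).ne'))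
    (by exact_mod_cast (Real.sqrt_pos.2 ht).ne')
  have hc0 : (∏ _i : Fin n, ∏ _j : Fin m, mixConst q t ^ 2) ≠ 0 :=
    prod_ne_zero_iff.2 fun _ _ => prod_ne_zero_iff.2 fun _ _ => pow_ne_zero _ hm
  have hsh := fun (F : (Fin n → ℂ) → (Fin m → ℂ) → ℂ) (x : Fin m → ℂ) (y : Fin n → ℂ) =>
    xShift_dualFun hq ht j F (x := x) (y := y)
  have hΔ := fun x y => DeltaNM_dual (n := n) (m := m) hq ht (x := x) (y := y)
  generalize (∏ l : Fin m, if l ≠ j then q else 1) * ∏ _i : Fin n, t = κ at hκ0 hsh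
  generalize (∏ _i : Fin n, ∏ _j : Fin m, mixConst q t ^ 2) = c at hc0 hΔ
  have hξi := inv_pos.2 hξ
  have hξi' := inv_pos.2 hξ'
  refine SameInt.of_const_mul (c := c * κ) (mul_ne_zero hc0 (by exact_mod_cast hκ0)) (.of_dual ?_)
  refine (sameInt_xShift ht ht1 hq hq1 hξi' hξi (h.dual hξ hξ') j hP.dualFun hQ.dualFun).congr
    hξi' hξi (fun x y hx hy => ?_) fun x y hx hy => ?_
  · have h1 := hΔ y⁻¹ x⁻¹ (fun i => inv_ne_zero (hy i)) fun i => inv_ne_zero (hx i)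
    rw [inv_inv, inv_inv] at h1
    rw [hsh P x y hx hy, starFun_dualFun, h1]
    simp only [dualFun]
    ring
  · have h1 := hΔ y⁻¹ x⁻¹ (fun i => inv_ne_zero (hy i)) fun i => inv_ne_zero (hx i)
    rw [inv_inv, inv_inv] at h1
    have h2 : starFun (xShift t q j (dualFun Q)) x y =
        κ * dualFun (starFun (yShift q t j Q)) x y := by
      rw [← starFun_dualFun, starFun, hsh Q _ _ (fun i => by simpa using hx i)
        fun i => by simpa using hy i, map_mul, Complex.conj_ofReal]
      rfl
    rw [h1, h2]
    simp only [dualFun]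
    ring

end Duality

section Symmetry

variable {n m : ℕ} {q t ξ ξ' : ℝ}

lemma SameInt.const_mul {F G : (Fin n → ℂ) → (Fin m → ℂ) → ℂ} (h : SameInt ξ ξ' F G) (c : ℂ) :
    SameInt ξ ξ' (fun x y => c * F x y) fun x y => c * G x y := by
  obtain ⟨h1, h2, h3⟩ := h
  refine ⟨h1.const_mul c, h2.const_mul c, ?_⟩
  simp only [torusInt, integral_const_mul] at h3 ⊢
  rw [h3]

lemma SameInt.add {F G F' G' : (Fin n → ℂ) → (Fin m → ℂ) → ℂ} (h : SameInt ξ ξ' F G)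
    (h' : SameInt ξ ξ' F' G') :
    SameInt ξ ξ' (fun x y => F x y + F' x y) fun x y => G x y + G' x y := by
  refine ⟨h.1.add h'.1, h.2.1.add h'.2.1, ?_⟩
  have e := h.2.2
  have e' := h'.2.2
  simp only [torusInt] at e e' ⊢
  rw [integral_add h.1 h'.1, integral_add h.2.1 h'.2.1, e, e']

lemma SameInt.sum {ι : Type*} {s : Finset ι} {F G : ι → (Fin n → ℂ) → (Fin m → ℂ) → ℂ}
    (h : ∀ k, SameInt ξ ξ' (F k) (G k)) :
    SameInt ξ ξ' (fun x y => ∑ k ∈ s, F k x y) fun x y => ∑ k ∈ s, G k x y := by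
  refine ⟨integrable_finsetSum _ fun k _ => (h k).1,
    integrable_finsetSum _ fun k _ => (h k).2.1, ?_⟩
  simp only [torusInt]
  rw [integral_finsetSum _ fun k _ => (h k).1, integral_finsetSum _ fun k _ => (h k).2.1]
  exact sum_congr rfl fun k _ => (h k).2.2

lemma GenericPt.conj_inv {x : Fin n → ℂ} {y : Fin m → ℂ} (h : GenericPt q t x y) :
    GenericPt q t (fun i => (starRingEnd ℂ (x i))⁻¹) fun j => (starRingEnd ℂ (y j))⁻¹ where
  x_ne_zero i := by simpa using h.x_ne_zero i
  y_ne_zero j := by simpa using h.y_ne_zero j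
  x_ne i k hik e := h.x_ne i k hik ((starRingEnd ℂ).injective (inv_injective e))
  y_ne j l hjl e := h.y_ne j l hjl ((starRingEnd ℂ).injective (inv_injective e))
  mul_x_ne i j e := h.inv.mul_x_ne i j (by
    have := congrArg (starRingEnd ℂ) e
    simpa using this)
  x_ne_mul i j e := h.inv.x_ne_mul i j (by
    have := congrArg (starRingEnd ℂ) e
    simpa using this)

lemma starFun_McalOp (hq : 0 < q) (hq1 : q < 1) (ht : 0 < t) (ht1 : t < 1)
    (F : (Fin n → ℂ) → (Fin m → ℂ) → ℂ) {x : Fin n → ℂ} {y : Fin m → ℂ} (h : GenericPt q t x y) :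
    starFun (McalOp n m q t F) x y =
      xCoef n q t * ∑ i, starFun (xShift q t i F) x y +
      yCoef m q t * ∑ j, starFun (yShift q t j F) x y - shiftConst n m q t * starFun F x y := by
  simp only [starFun, McalOp_eq hq hq1 ht ht1 F h.conj_inv, map_sub, map_add, map_mul, map_sum,
    Complex.conj_ofReal, xShift, yShift]

lemma starFun_ratioProd_mul {F : (Fin n → ℂ) → (Fin m → ℂ) → ℂ}
    {x : Fin n → ℂ} {y : Fin m → ℂ} :
    starFun (fun x y => ratioProd x * ratioProd y * F x y) x y =
      ratioProd x * ratioProd y * starFun F x y := by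
  have h : ∀ {k : ℕ} (z : Fin k → ℂ),
      starRingEnd ℂ (ratioProd fun i => (starRingEnd ℂ (z i))⁻¹) = ratioProd z := by
    intro k z
    rw [ratioProd, prod_comm, ratioProd, map_prod]
    refine prod_congr rfl fun i _ => ?_
    rw [map_prod]
    refine prod_congr rfl fun l _ => ?_
    simp only [apply_ite (starRingEnd ℂ), map_sub, map_one, map_div₀,
      Complex.conj_conj, inv_div_inv, ne_comm (a := l)]
  simp only [starFun, map_mul, h]

/-- The deformed operator is symmetric when the radii of the torus are far apart. -/
lemma torusInt_McalOp_eq (hq : 0 < q) (hq1 : q < 1) (ht : 0 < t) (ht1 : t < 1)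
    (hξ : 0 < ξ) (hξ' : 0 < ξ') (h : Separated q t ξ ξ')
    {P Q : (Fin n → ℂ) → (Fin m → ℂ) → ℂ} (hP : DiffNeZero P) (hQ : DiffNeZero Q) :
    torusInt ξ ξ' (fun x y => DeltaNM n m q t x y * McalOp n m q t P x y * starFun Q x y) =
      torusInt ξ ξ' fun x y => DeltaNM n m q t x y * P x y * starFun (McalOp n m q t Q) x y := by
  have h0 : SameInt ξ ξ' (fun x y => DeltaNM n m q t x y * P x y * starFun Q x y)
      (fun x y => DeltaNM n m q t x y * P x y * starFun Q x y) := by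
    have hi := integrable_comp_torusPt (n := n) (m := m) (ξ := ξ) (ξ' := ξ')
      (F := fun x y => DeltaNM n m q t x y * P x y * starFun Q x y) fun w => by
        have hx := torusPt_ne_zero hξ w.1
        have hy := torusPt_ne_zero hξ' w.2
        have hc := fun i j => ne_one_of_separated hq hq1 ht ht1 hξ hξ' h
          (norm_torusPt hξ w.1 i) (norm_torusPt hξ' w.2 j)
        have hD : DiffAt₂ (DeltaNM n m q t) (torusPt ξ w.1) (torusPt ξ' w.2) := by
          have := diffAt₂_weight (fun _ => 1) (fun _ => 1) hq hq1 ht ht1 hx hy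
            (fun i k => (norm_torusPt hξ w.1 i).trans (norm_torusPt hξ w.1 k).symm)
            (fun i k => (norm_torusPt hξ' w.2 i).trans (norm_torusPt hξ' w.2 k).symm)
            (fun i j => (hc i j).1) fun i j => (hc i j).2
          simpa only [← DeltaW_eq_weightProd, ← DeltaNM_eq] using this
        exact (hD.mul (hP _ _ hx hy)).mul (diffAt₂_starFun hQ hx hy)
    exact ⟨hi, hi, rfl⟩
  have h1 := (((SameInt.sum (s := univ) fun i => sameInt_xShift hq hq1 ht ht1 hξ hξ' h i hP hQ
    ).const_mul (xCoef n q t)).add ((SameInt.sum (s := univ) fun j => sameInt_yShift hq hq1 ht ht1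
      hξ hξ' h j hP hQ).const_mul (yCoef m q t))).add (h0.const_mul (-shiftConst n m q t))
  refine Eq.trans (integral_congr_ae ?_) (h1.2.2.trans (integral_congr_ae ?_))
  · filter_upwards [ae_genericPt hq ht hξ hξ'] with w hw
    rw [McalOp_eq hq hq1 ht ht1 P hw]
    simp only [← mul_sum, ← sum_mul, xShift, yShift]
    ring
  · filter_upwards [ae_genericPt hq ht hξ hξ'] with w hw
    rw [starFun_McalOp hq hq1 ht ht1 Q hw]
    simp only [← mul_sum]
    ring

/-- The inequalities satisfied by admissible radii, without division. -/
lemma Admissible.cases (hq : 0 < q) (ht : 0 < t) (hξ : 0 < ξ)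
    (hξ' : 0 < ξ') (h : Admissible q t ξ ξ') :
    (√q * ξ' < √t * ξ ∧ √t * ξ' < √q * ξ) ∨ (√t * ξ < √q * ξ' ∧ √q * ξ < √t * ξ') := by
  have hq' := Real.sqrt_pos.2 hq
  have ht' := Real.sqrt_pos.2 ht
  rw [Admissible, Mmax] at h
  have h0 : 0 < max (√q / √t) (√t / √q) := lt_max_of_lt_left (by positivity)
  refine h.imp (fun h => ?_) fun h => ?_
  · obtain ⟨h1, h2⟩ := max_lt_iff.1 h
    rw [div_lt_div_iff₀ (by positivity) (by positivity)] at h1 h2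
    constructor <;> linarith
  · rw [inv_eq_one_div, lt_div_iff₀ h0] at h
    have h3 : 0 ≤ ξ / ξ' := by positivity
    have h1 := (mul_le_mul_of_nonneg_left (le_max_right (√q / √t) (√t / √q)) h3).trans_lt h
    have h2 := (mul_le_mul_of_nonneg_left (le_max_left (√q / √t) (√t / √q)) h3).trans_lt h
    rw [div_mul_div_comm, div_lt_one (by positivity)] at h1 h2
    constructor <;> linarith

/-- Away from the poles of the mixed factor, the regularised weight times a differentiable function
is differentiable near the rescaled torus. -/
lemma DiffNeZero.regDelta_mul {H : (Fin n → ℂ) → (Fin m → ℂ) → ℂ} (hH : DiffNeZero H)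
    (hq : 0 < q) (hq1 : q < 1) (ht : 0 < t) (ht1 : t < 1) (hξ : 0 < ξ) (hξ' : 0 < ξ')
    (w : Torus n m) {s : ℂ} (hs : s ≠ 0) (h1 : √t * (‖s‖ * ξ) ≠ √q * ξ')
    (h2 : √t * ξ' ≠ √q * (‖s‖ * ξ)) :
    DiffAt₂ (fun x y => regDelta q t x y * H x y) (scaleOn univ s (torusPt ξ w.1))
      (torusPt ξ' w.2) := by
  have hq' := Real.sqrt_pos.2 hq
  have ht' := Real.sqrt_pos.2 ht
  have hs' := norm_pos_iff.2 hs
  have hx := scaleOn_ne_zero (S := univ) hs (torusPt_ne_zero hξ w.1)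
  have hy := torusPt_ne_zero hξ' w.2
  have hn : ∀ i, ‖scaleOn univ s (torusPt ξ w.1) i‖ = ‖s‖ * ξ := fun i => by
    simp only [scaleOn, mem_univ, if_true, norm_mul, norm_torusPt hξ]
  refine .mul (diffAt₂_weight (fun _ => q) (fun _ => t) hq hq1 ht ht1 hx hy
    (fun i k => (hn i).trans (hn k).symm)
    (fun i k => (norm_torusPt hξ' w.2 i).trans (norm_torusPt hξ' w.2 k).symm)
    (fun i j => ?_) fun i j => ?_) (hH _ _ hx hy)
  · rw [norm_mul, norm_div, norm_mixConst, hn, norm_torusPt hξ', div_mul_div_comm, ne_eq,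
      div_eq_one_iff_eq (by positivity)]
    exact h1
  · rw [norm_mul, norm_div, norm_mixConst, hn, norm_torusPt hξ', div_mul_div_comm, ne_eq,
      div_eq_one_iff_eq (by positivity)]
    exact h2

lemma DiffNeZero.continuous_regDelta_mul {H : (Fin n → ℂ) → (Fin m → ℂ) → ℂ} (hH : DiffNeZero H)
    (hq : 0 < q) (hq1 : q < 1) (ht : 0 < t) (ht1 : t < 1) (hξ : 0 < ξ) (hξ' : 0 < ξ')
    (h : Admissible q t ξ ξ') :
    Continuous fun w : Torus n m =>
      regDelta q t (torusPt ξ w.1) (torusPt ξ' w.2) * H (torusPt ξ w.1) (torusPt ξ' w.2) := by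
  refine continuous_comp_torusPt (F := fun x y => regDelta q t x y * H x y) fun w => ?_
  have := hH.regDelta_mul hq hq1 ht ht1 hξ hξ' w one_ne_zero
    (by rw [norm_one, one_mul]; rcases h.cases hq ht hξ hξ' with h | h; exacts [h.1.ne', h.1.ne])
    (by rw [norm_one, one_mul]; rcases h.cases hq ht hξ hξ' with h | h; exacts [h.2.ne, h.2.ne'])
  rwa [scaleOn_one] at this

/-- Admissible radii can be moved to widely separated ones without changing integrals against the
regularised weight. -/
lemma exists_separated (hq : 0 < q) (hq1 : q < 1) (ht : 0 < t) (ht1 : t < 1)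
    (hξ : 0 < ξ) (hξ' : 0 < ξ') (h : Admissible q t ξ ξ') :
    ∃ η, 0 < η ∧ Separated q t η ξ' ∧ ∀ H : (Fin n → ℂ) → (Fin m → ℂ) → ℂ, DiffNeZero H →
      torusInt ξ ξ' (fun x y => regDelta q t x y * H x y) =
        torusInt η ξ' fun x y => regDelta q t x y * H x y := by
  have hq' := Real.sqrt_pos.2 hq
  have ht' := Real.sqrt_pos.2 ht
  have hsc : ∀ (c : ℝ) (F : (Fin n → ℂ) → (Fin m → ℂ) → ℂ),
      torusInt ξ ξ' (fun x y => F (scaleOn univ (c : ℂ) x) y) = torusInt (c * ξ) ξ' F := by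
    intro c F
    have e : ∀ u : Fin n → AddCircle (2 * Real.pi),
        scaleOn univ (c : ℂ) (torusPt ξ u) = torusPt (c * ξ) u := by
      intro u
      funext i
      simp only [scaleOn, mem_univ, if_true, torusPt, ofReal_mul, mul_assoc]
    simp only [torusInt, e]
  rcases h.cases hq ht hξ hξ' with ⟨h1, h2⟩ | ⟨h1, h2⟩
  · let b := 1 + ξ' / (√q * √t * ξ)
    have hb : 1 ≤ b := le_add_of_nonneg_right (by positivity)
    refine ⟨b * ξ, by positivity, .inl ?_, fun H hH => ?_⟩
    · have : √q * √t * (b * ξ) = √q * √t * ξ + ξ' := by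
        simp only [b]; field_simp
      rw [this]
      exact lt_add_of_pos_left _ (by positivity)
    · have := torusInt_scaleOn_eq (ξ := ξ) (ξ' := ξ') (fun x y => regDelta q t x y * H x y)
        univ one_pos hb fun w s hs _ => hH.regDelta_mul hq hq1 ht ht1 hξ hξ'
          w (norm_pos_iff.1 (by linarith)) ?_ ?_
      · have e1 := hsc b fun x y => regDelta q t x y * H x y
        have e2 := hsc 1 fun x y => regDelta q t x y * H x y
        rw [one_mul] at e2
        exact e2.symm.trans (this.symm.trans e1)
      · have : √t * ξ ≤ √t * (‖s‖ * ξ) := by gcongr; exact le_mul_of_one_le_left hξ.le hs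
        exact (h1.trans_le this).ne'
      · have : √q * ξ ≤ √q * (‖s‖ * ξ) := by gcongr; exact le_mul_of_one_le_left hξ.le hs
        exact (h2.trans_le this).ne
  · let a := (√q * √t * ξ') / (ξ + √q * √t * ξ')
    have ha : 0 < a := by positivity
    have ha1 : a ≤ 1 := by
      rw [div_le_one (by positivity)]
      exact le_add_of_nonneg_left hξ.le
    refine ⟨a * ξ, by positivity, .inr ?_, fun H hH => ?_⟩
    · simp only [a]
      rw [div_mul_eq_mul_div, div_lt_iff₀ (by positivity)]
      nlinarith [mul_pos (mul_pos (mul_pos hq' ht') hξ') (mul_pos (mul_pos hq' ht') hξ')]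
    · have := torusInt_scaleOn_eq (ξ := ξ) (ξ' := ξ') (fun x y => regDelta q t x y * H x y)
        univ ha ha1 fun w s hs hs' => hH.regDelta_mul hq hq1 ht ht1 hξ hξ'
          w (norm_pos_iff.1 (by linarith)) ?_ ?_
      · have e1 := hsc a fun x y => regDelta q t x y * H x y
        have e2 := hsc 1 fun x y => regDelta q t x y * H x y
        rw [one_mul] at e2
        exact e2.symm.trans (this.trans e1)
      · have : √t * (‖s‖ * ξ) ≤ √t * ξ := by gcongr; exact mul_le_of_le_one_left hξ.le hs'
        exact (this.trans_lt h1).ne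
      · have : √q * (‖s‖ * ξ) ≤ √q * ξ := by gcongr; exact mul_le_of_le_one_left hξ.le hs'
        exact (this.trans_lt h2).ne'

end Symmetry

lemma pairingNM_eq_torusInt {n m : ℕ} {q t ξ ξ' : ℝ} (hq : 0 < q) (ht : 0 < t)
    (hξ : 0 < ξ) (hξ' : 0 < ξ') (F E G : (Fin n → ℂ) → (Fin m → ℂ) → ℂ)
    (hG : Continuous fun w : Torus n m => G (torusPt ξ w.1) (torusPt ξ' w.2))
    (hFG : ∀ x y, GenericPt q t x y → DeltaNM n m q t x y * F x y * starFun E x y = G x y) :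
    pairingNM n m q t F E ξ ξ' =
      1 / ((n.factorial : ℂ) * (m.factorial : ℂ)) * (1 / (2 * (Real.pi : ℂ)) ^ (n + m)) *
        torusInt ξ ξ' G := by
  have hae : ∀ᵐ w : Torus n m,
      (fun x y => DeltaNM n m q t x y * F x y * starFun E x y) (torusPt ξ w.1) (torusPt ξ' w.2) =
        G (torusPt ξ w.1) (torusPt ξ' w.2) := by
    filter_upwards [ae_genericPt hq ht hξ hξ'] with w hw using hFG _ _ hw
  rw [pairingNM]
  congr 1
  exact (integral_box_eq_torusInt (fun x y => DeltaNM n m q t x y * F x y * starFun E x y) G hG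
    hae).trans (integral_congr_ae hae)

theorem statement3 (n m : ℕ) (hn : 1 ≤ n) (hm : 1 ≤ m) (q t : ℝ)
    (hq0 : 0 < q) (hq1 : q < 1) (ht0 : 0 < t) (ht1 : t < 1)
    (ξ ξ' : ℝ) (hξ : 0 < ξ) (hξ' : 0 < ξ') (hadm : Admissible q t ξ ξ')
    (P Q : (Fin n → ℂ) → (Fin m → ℂ) → ℂ)
    (hP : InLambda n m q t P) (hQ : InLambda n m q t Q) :
    pairingNM n m q t (McalOp n m q t P) Q ξ ξ' =
      pairingNM n m q t P (McalOp n m q t Q) ξ ξ' := by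
  have hP' : DiffNeZero P := fun x y _ _ => IsPolyFun.diffAt₂ hP.1 x y
  have hQ' : DiffNeZero Q := fun x y _ _ => IsPolyFun.diffAt₂ hQ.1 x y
  obtain ⟨HP, hHP, eP⟩ := exists_ratioProd_mul_McalOp hq0 hq1 ht0 ht1 hP
  obtain ⟨HQ, hHQ, eQ⟩ := exists_ratioProd_mul_McalOp hq0 hq1 ht0 ht1 hQ
  let K₁ : (Fin n → ℂ) → (Fin m → ℂ) → ℂ := fun x y => HP x y * starFun Q x y
  let K₂ : (Fin n → ℂ) → (Fin m → ℂ) → ℂ := fun x y => P x y * starFun HQ x y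
  have hK₁ : DiffNeZero K₁ := fun x y hx hy => (hHP x y hx hy).mul (diffAt₂_starFun hQ' hx hy)
  have hK₂ : DiffNeZero K₂ := fun x y hx hy => (hP' x y hx hy).mul (diffAt₂_starFun hHQ hx hy)
  have e₁ : ∀ x y, GenericPt q t x y →
      DeltaNM n m q t x y * McalOp n m q t P x y * starFun Q x y =
        regDelta q t x y * K₁ x y := fun x y h => by
    simp only [K₁]
    rw [← eP x y h, ← ratioProd_mul_regDelta hq0 hq1 ht0 ht1]
    ring
  have e₂ : ∀ x y, GenericPt q t x y →
      DeltaNM n m q t x y * P x y * starFun (McalOp n m q t Q) x y =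
        regDelta q t x y * K₂ x y := fun x y h => by
    have e : starFun HQ x y = ratioProd x * ratioProd y * starFun (McalOp n m q t Q) x y := by
      rw [← starFun_ratioProd_mul, starFun, starFun, eQ _ _ h.conj_inv]
    simp only [K₂]
    rw [e, ← ratioProd_mul_regDelta hq0 hq1 ht0 ht1]
    ring
  obtain ⟨η, hη, hsep, hmove⟩ := exists_separated (n := n) (m := m) hq0 hq1 ht0 ht1 hξ hξ' hadm
  rw [pairingNM_eq_torusInt hq0 ht0 hξ hξ' _ _ (fun x y => regDelta q t x y * K₁ x y)
      (hK₁.continuous_regDelta_mul hq0 hq1 ht0 ht1 hξ hξ' hadm) e₁,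
    pairingNM_eq_torusInt hq0 ht0 hξ hξ' _ _ (fun x y => regDelta q t x y * K₂ x y)
      (hK₂.continuous_regDelta_mul hq0 hq1 ht0 ht1 hξ hξ' hadm) e₂,
    hmove K₁ hK₁, hmove K₂ hK₂]
  congr 1
  refine Eq.trans (integral_congr_ae ?_)
    ((torusInt_McalOp_eq hq0 hq1 ht0 ht1 hη hξ' hsep hP' hQ').trans (integral_congr_ae ?_))
  · filter_upwards [ae_genericPt hq0 ht0 hη hξ'] with w hw using (e₁ _ _ hw).symm
  · filter_upwards [ae_genericPt hq0 ht0 hη hξ'] with w hw using e₂ _ _ hw
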